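/- arXiv:2311.01569 — 3 statements merged into one kernel-verified Lean document; each statement's English description precedes it below -/
import Mathlib

section
/- For every real number x with 0 < x ≤ 2, the rescaled bubble-size counts converge: the sequence n ↦ (n-1)·B_{n,⌊x(n-1)⌋} / (∑_{p=1}^{2n-2} B_{n,p}) tends, as n → ∞, to ρ(x) = e·(6-x)·e^{-x/2} / (2·(4e-2)), where e is Euler's number. -/
open Finset

/-- A linear chord diagram on `2*n` vertices: a fixed-point-free involution of `Fin (2*n)`.
Vertex `v ∈ {1,...,2n}` is represented by the index `v-1 : Fin (2*n)`. -/
def IsLCD (n : ℕ) (f : Fin (2*n) → Fin (2*n)) : Prop :=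
  ∀ i, f (f i) = i ∧ f i ≠ i

/-- The chord `{i, i+1}` (1-based vertices) is a short chord of `f`. -/
def IsShort (n : ℕ) (f : Fin (2*n) → Fin (2*n)) (i : ℕ) : Prop :=
  ∃ (_h1 : 1 ≤ i) (h2 : i < 2*n), f ⟨i-1, by omega⟩ = ⟨i, h2⟩

/-- The interval `[a,b] ⊆ {1,...,2n}` (1-based) is a bubble of the diagram `f`:
it contains no short chord, its left end is the start of the diagram or is preceded
by the short chord `{a-2,a-1}`, and its right end is the end of the diagram or is
followed by the short chord `{b+1,b+2}`. -/
def IsBubble (n : ℕ) (f : Fin (2*n) → Fin (2*n)) (a b : ℕ) : Prop :=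
  1 ≤ a ∧ a ≤ b ∧ b ≤ 2*n ∧
  (∀ i, a ≤ i → i + 1 ≤ b → ¬ IsShort n f i) ∧
  (a = 1 ∨ IsShort n f (a-2)) ∧
  (b = 2*n ∨ IsShort n f (b+1))

open scoped Classical in
/-- `B n p` : the number of pairs `(D, [a,b])` where `D` is a linear chord diagram on
`2n` vertices and `[a,b]` is a bubble of `D` of size `p = b - a + 1`. -/
noncomputable def B (n p : ℕ) : ℕ :=
  ((univ ×ˢ (Finset.Icc 1 (2*n) ×ˢ Finset.Icc 1 (2*n))).filter
    (fun x : (Fin (2*n) → Fin (2*n)) × ℕ × ℕ =>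
      IsLCD n x.1 ∧ IsBubble n x.1 x.2.1 x.2.2 ∧ x.2.2 - x.2.1 + 1 = p)).card

open scoped Classical in
/-- `d n s` : the number of linear chord diagrams on `2n` vertices having exactly `s`
short chords. -/
noncomputable def d (n s : ℕ) : ℕ :=
  (univ.filter (fun f : Fin (2*n) → Fin (2*n) =>
    IsLCD n f ∧ ((Finset.Icc 1 (2*n-1)).filter (fun i => IsShort n f i)).card = s)).card

open scoped Classical in
/-- `pathMatch m j` : the number of `j`-edge matchings of the path graph on `m` vertices
`{1,...,m}` with edges `{i,i+1}`, `1 ≤ i ≤ m-1`.  An edge is encoded by its left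
endpoint; a set of edges is a matching iff no two left endpoints are consecutive. -/
noncomputable def pathMatch (m j : ℕ) : ℕ :=
  (((Finset.Icc 1 (m-1)).powerset).filter
    (fun S => S.card = j ∧ ∀ i ∈ S, i + 1 ∉ S)).card

/-- The double factorial `(2m-1)!! = (2m)! / (2^m * m!)`, so `(-1)!! = 1`. -/
def doubleFact (m : ℕ) : ℕ := (2*m).factorial / (2^m * m.factorial)

open Equiv

/-- `f` is an involution whose non-fixed points are exactly the elements of `V`,
i.e. a perfect matching of `V` extended by the identity. -/
def FpfOn {α : Type*} (V : Finset α) (f : α → α) : Prop :=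
  ∀ i, f (f i) = i ∧ (f i ≠ i ↔ i ∈ V)

/-- `f` matches no two consecutive vertices of the path `w 0, …, w (p - 1)`. -/
def AvoidsPath {α : Type*} (w : ℕ → α) (p : ℕ) (f : α → α) : Prop :=
  ∀ i, i + 1 < p → f (w i) ≠ w (i + 1)

/-- The number `(2k-1)!!` of perfect matchings of `2k` points. -/
def matchCount (k : ℕ) : ℕ := ∏ i ∈ range k, (2 * i + 1)

/-- The number of perfect matchings of `2k` points using no edge of a path on `p` of them. -/
def avoidCount : ℕ → ℕ → ℤ
  | k, 0 => matchCount k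
  | k, 1 => matchCount k
  | k, p + 2 => avoidCount k (p + 1) - avoidCount (k - 1) p

section Matchings

variable {α : Type*} [DecidableEq α]

lemma FpfOn.swap_apply {V : Finset α} {f : α → α} {u v x : α} (hf : FpfOn V f) (huv : f u = v)
    (hxu : x ≠ u) (hxv : x ≠ v) : swap u v (f x) = f x := by
  have h1 := (hf x).1
  have h2 := (hf u).1
  refine swap_apply_of_ne_of_ne ?_ ?_ <;> intro h <;> simp_all

lemma fpfOn_swap_comp {V : Finset α} {f : α → α} {u v : α} (hu : u ∈ V) (hv : v ∈ V)
    (huv : u ≠ v) : FpfOn (V \ {u, v}) (swap u v ∘ f) ↔ FpfOn V f ∧ f u = v := by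
  constructor
  · intro h
    have hfu : f u = v := by
      have := (h u).2
      simp only [Function.comp, mem_sdiff, mem_insert, true_or, not_true, and_false, iff_false,
        ne_eq, not_not] at this
      rw [swap_apply_eq_iff] at this
      simpa using this
    have hfv : f v = u := by
      have := (h v).2
      simp only [Function.comp, mem_sdiff, mem_insert, mem_singleton, or_true, not_true, and_false,
        iff_false, ne_eq, not_not] at this
      rw [swap_apply_eq_iff] at this
      simpa using this
    refine ⟨fun i => ?_, hfu⟩
    rcases eq_or_ne i u with rfl | hiu
    · simp [hfu, hfv, hu, huv.symm]
    rcases eq_or_ne i v with rfl | hiv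
    · simp [hfu, hfv, hv, huv]
    have hi := h i
    simp only [Function.comp, mem_sdiff, mem_insert, mem_singleton, hiu, hiv, or_self,
      not_false_iff, and_true] at hi
    have h1 : f i ≠ u := by
      intro e
      rw [e, swap_apply_left, hfv, swap_apply_left] at hi
      exact hiv hi.1.symm
    have h2 : f i ≠ v := by
      intro e
      rw [e, swap_apply_right, hfu, swap_apply_right] at hi
      exact hiu hi.1.symm
    rw [swap_apply_of_ne_of_ne h1 h2] at hi
    refine ⟨?_, hi.2⟩
    have := hi.1
    rw [swap_apply_eq_iff, swap_apply_of_ne_of_ne hiu hiv] at this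
    exact this
  · rintro ⟨h, hfu⟩ i
    have hfv : f v = u := by rw [← hfu]; exact (h u).1
    rcases eq_or_ne i u with rfl | hiu
    · simp [hfu]
    rcases eq_or_ne i v with rfl | hiv
    · simp [hfv]
    have h1 := h.swap_apply hfu hiu hiv
    simp only [Function.comp, h1, mem_sdiff, mem_insert, mem_singleton, hiu, hiv, or_self,
      not_false_iff, and_true, (h i).2, (h i).1]
    exact swap_apply_of_ne_of_ne hiu hiv

lemma card_sdiff_pair {V : Finset α} {u v : α} (hu : u ∈ V) (hv : v ∈ V) (huv : u ≠ v) {k : ℕ}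
    (hV : V.card = 2 * (k + 1)) : (V \ {u, v}).card = 2 * k := by
  rw [card_sdiff_of_subset (by simp [insert_subset_iff, hu, hv]), card_pair huv, hV]
  omega

lemma AvoidsPath.swap_comp_iff {V : Finset α} {f : α → α} {u v : α} (hf : FpfOn V f)
    (huv : f u = v) {w : ℕ → α} {p : ℕ} (hw : ∀ i < p, w i ≠ u ∧ w i ≠ v) :
    AvoidsPath w p f ↔ AvoidsPath w p (swap u v ∘ f) := by
  refine forall₂_congr fun i hi => ?_
  have := hw i (by omega)
  rw [Function.comp, hf.swap_apply huv this.1 this.2]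

variable [Fintype α]

open scoped Classical in
/-- Removing the chord `{u, v}` from the matchings of `V` containing it. -/
lemma card_fpfOn_remove {V : Finset α} {u v : α} (hu : u ∈ V) (hv : v ∈ V) (huv : u ≠ v)
    {P Q : (α → α) → Prop}
    (h : ∀ f, FpfOn V f → f u = v → (P f ↔ Q (swap u v ∘ f))) :
    #{f : α → α | FpfOn V f ∧ f u = v ∧ P f} = #{g : α → α | FpfOn (V \ {u, v}) g ∧ Q g} := by
  have hinv : Function.Involutive (fun f : α → α => swap u v ∘ f) := fun f => by
    ext x; simp
  refine Finset.card_equiv hinv.toPerm fun f => ?_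
  simp only [mem_filter, mem_univ, true_and, Function.Involutive.coe_toPerm,
    fpfOn_swap_comp hu hv huv]
  constructor
  · rintro ⟨h1, h2, h3⟩; exact ⟨⟨h1, h2⟩, (h f h1 h2).1 h3⟩
  · rintro ⟨⟨h1, h2⟩, h3⟩; exact ⟨h1, h2, (h f h1 h2).2 h3⟩

open scoped Classical in
lemma card_fpfOn (k : ℕ) : ∀ V : Finset α, V.card = 2 * k →
    #{f : α → α | FpfOn V f} = matchCount k := by
  induction k with
  | zero =>
    intro V hV
    obtain rfl : V = ∅ := by simpa using hV
    have : univ.filter (fun f : α → α => FpfOn ∅ f) = {id} := by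
      ext f
      rw [mem_filter, mem_singleton]
      constructor
      · intro h; ext i; simpa using (h.2 i).2
      · rintro rfl; simp [FpfOn]
    simp [this, matchCount]
  | succ k ih =>
    intro V hV
    obtain ⟨u, hu⟩ : V.Nonempty := by rw [← card_pos]; omega
    have hmap : ∀ f ∈ ({f : α → α | FpfOn V f} : Finset (α → α)), f u ∈ V.erase u := by
      intro f hf
      have hf : FpfOn V f := by simpa using hf
      have h1 := (hf u).2.2 hu
      refine mem_erase.2 ⟨h1, (hf (f u)).2.1 ?_⟩
      rw [(hf u).1]; exact h1.symm
    rw [card_eq_sum_card_fiberwise hmap, sum_congr rfl (g := fun _ => matchCount k), sum_const,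
      card_erase_of_mem hu, hV, smul_eq_mul, matchCount, matchCount, prod_range_succ, mul_comm]
    · congr 1
    · intro v hv
      obtain ⟨hvu, hv⟩ := mem_erase.1 hv
      rw [filter_filter, ← ih (V \ {u, v}) (card_sdiff_pair hu hv hvu.symm hV)]
      have := card_fpfOn_remove (P := fun _ => True) (Q := fun _ => True) hu hv hvu.symm
        (by simp)
      simpa using this

open scoped Classical in
lemma card_avoidsPath (w : ℕ → α) (p : ℕ) : ∀ (k : ℕ) (V : Finset α), V.card = 2 * k →
    (∀ i < p, w i ∈ V) → (∀ i < p, ∀ j < p, w i = w j → i = j) →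
    (#{f : α → α | FpfOn V f ∧ AvoidsPath w p f} : ℤ) = avoidCount k p := by
  induction p using Nat.twoStepInduction with
  | zero => intro k V hV _ _; simp [AvoidsPath, avoidCount, card_fpfOn k V hV]
  | one => intro k V hV _ _; simp [AvoidsPath, avoidCount, card_fpfOn k V hV]
  | more p ih0 ih1 =>
    intro k V hV hw hinj
    have hu := hw p (by omega)
    have hv := hw (p + 1) (by omega)
    have huv : w p ≠ w (p + 1) := fun h => by
      have := hinj _ (by omega) _ (by omega) h; omega
    obtain ⟨k, rfl⟩ : ∃ l, k = l + 1 := by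
      have := card_pos.2 ⟨_, hu⟩
      exact ⟨k - 1, by omega⟩
    have hne : ∀ i < p, w i ≠ w p ∧ w i ≠ w (p + 1) := fun i hi =>
      ⟨fun h => by have := hinj _ (by omega) _ (by omega) h; omega,
        fun h => by have := hinj _ (by omega) _ (by omega) h; omega⟩
    have h0 := ih0 k (V \ {w p, w (p + 1)}) (card_sdiff_pair hu hv huv hV)
      (fun i hi => by simp [hw i (by omega), hne i hi])
      (fun i hi j hj => hinj i (by omega) j (by omega))
    have h1 := ih1 (k + 1) V hV (fun i hi => hw i (by omega))
      (fun i hi j hj => hinj i (by omega) j (by omega))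
    have h2 := card_fpfOn_remove (P := AvoidsPath w (p + 1)) (Q := AvoidsPath w p) hu hv huv
      (fun f hf hfu => by
        rw [← AvoidsPath.swap_comp_iff hf hfu hne]
        refine ⟨fun h i hi => h i (by omega), fun h i hi => ?_⟩
        rcases Nat.lt_or_ge (i + 1) p with h' | h'
        · exact h i h'
        · obtain rfl : p = i + 1 := by omega
          intro h3
          have h4 := (hf (w i)).1
          rw [h3, hfu] at h4
          have := hinj _ (by omega) _ (by omega) h4
          omega)
    have h3 := card_filter_add_card_filter_not
      (s := ({f : α → α | FpfOn V f ∧ AvoidsPath w (p + 1) f} : Finset (α → α)))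
      (fun f => f (w p) = w (p + 1))
    rw [filter_filter, filter_filter] at h3
    have e1 : univ.filter (fun f : α → α =>
          (FpfOn V f ∧ AvoidsPath w (p + 1) f) ∧ f (w p) = w (p + 1)) =
        univ.filter (fun f => FpfOn V f ∧ f (w p) = w (p + 1) ∧ AvoidsPath w (p + 1) f) :=
      filter_congr fun f _ => by tauto
    have e2 : univ.filter (fun f : α → α =>
          (FpfOn V f ∧ AvoidsPath w (p + 1) f) ∧ ¬ f (w p) = w (p + 1)) =
        univ.filter (fun f => FpfOn V f ∧ AvoidsPath w (p + 2) f) :=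
      filter_congr fun f _ => by
        rw [and_assoc]
        refine and_congr_right fun _ => ?_
        constructor
        · rintro ⟨h, h'⟩ i hi
          rcases Nat.lt_or_ge (i + 1) (p + 1) with h'' | h''
          · exact h i h''
          · obtain rfl : p = i := by omega
            exact h'
        · intro h
          exact ⟨fun i hi => h i (by omega), h p (by omega)⟩
    rw [e1, e2, h2] at h3
    rw [avoidCount, Nat.add_sub_cancel, ← h0, ← h1, ← h3]
    push_cast
    ring

end Matchings

section Bubbles

/-- The vertex with `0`-based index `i`. -/
def vertex {N : ℕ} (hN : 0 < N) (i : ℕ) : Fin N := ⟨i % N, Nat.mod_lt _ hN⟩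

lemma vertex_inj {N : ℕ} (hN : 0 < N) {i j : ℕ} (hi : i < N) (hj : j < N) :
    vertex hN i = vertex hN j ↔ i = j := by
  simp [vertex, Nat.mod_eq_of_lt hi, Nat.mod_eq_of_lt hj]

lemma isLCD_iff_fpfOn {n : ℕ} {f : Fin (2 * n) → Fin (2 * n)} :
    IsLCD n f ↔ FpfOn univ f := by
  simp [IsLCD, FpfOn]

lemma isShort_iff {n : ℕ} (hN : 0 < 2 * n) {f : Fin (2 * n) → Fin (2 * n)} {i : ℕ} :
    IsShort n f i ↔ 1 ≤ i ∧ i < 2 * n ∧ f (vertex hN (i - 1)) = vertex hN i := by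
  have key : ∀ j (hj : j < 2 * n), vertex hN j = ⟨j, hj⟩ := fun j hj => by
    simp [vertex, Nat.mod_eq_of_lt hj]
  constructor
  · rintro ⟨h1, h2, h3⟩
    exact ⟨h1, h2, by rw [key _ h2, key _ (by omega), h3]⟩
  · rintro ⟨h1, h2, h3⟩
    exact ⟨h1, h2, by rw [← key _ h2, ← key _ (by omega), h3]⟩

lemma forall_not_isShort_iff {n : ℕ} (hN : 0 < 2 * n) {f : Fin (2 * n) → Fin (2 * n)}
    {a p : ℕ} (ha : 1 ≤ a) (hp : 1 ≤ p) (hap : a + p - 1 ≤ 2 * n) :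
    (∀ i, a ≤ i → i + 1 ≤ a + p - 1 → ¬ IsShort n f i) ↔
      AvoidsPath (fun j => vertex hN (a - 1 + j)) p f := by
  constructor
  · intro h i hi h'
    refine h (a + i) (by omega) (by omega) ((isShort_iff hN).2 ⟨by omega, by omega, ?_⟩)
    rw [show a + i - 1 = a - 1 + i by omega, show a + i = a - 1 + (i + 1) by omega]
    exact h'
  · intro h i hai hi hs
    refine h (i - a) (by omega) ?_
    have := ((isShort_iff hN).1 hs).2.2
    dsimp only
    rw [show a - 1 + (i - a) = i - 1 by omega, show a - 1 + (i - a + 1) = i by omega]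
    exact this

open scoped Classical in
/-- Number of diagrams with a given chord `{u, v}` in which a path avoiding that chord
carries no short chord. -/
lemma card_chord_avoidsPath {α : Type*} [DecidableEq α] [Fintype α] {k : ℕ} {V : Finset α}
    (hV : V.card = 2 * (k + 1)) {u v : α} (hu : u ∈ V) (hv : v ∈ V) (huv : u ≠ v)
    {w : ℕ → α} {p : ℕ} (hw : ∀ i < p, w i ∈ V) (hinj : ∀ i < p, ∀ j < p, w i = w j → i = j)
    (hne : ∀ i < p, w i ≠ u ∧ w i ≠ v) :
    (#{f : α → α | FpfOn V f ∧ f u = v ∧ AvoidsPath w p f} : ℤ) = avoidCount k p := by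
  rw [card_fpfOn_remove (Q := AvoidsPath w p) hu hv huv
    fun f hf hfu => AvoidsPath.swap_comp_iff hf hfu hne]
  exact card_avoidsPath w p k _ (card_sdiff_pair hu hv huv hV)
    (fun i hi => by simp [hw i hi, hne i hi]) hinj

open scoped Classical in
/-- The number of diagrams in which `[a, a + p - 1]` is a bubble. -/
lemma card_isBubble {n p a : ℕ} (hp : 1 ≤ p) (hpn : p ≤ 2 * n - 2) (ha : 1 ≤ a) :
    (#{f | IsLCD n f ∧ IsBubble n f a (a + p - 1)} : ℤ) =
      (if a = 1 then avoidCount (n - 1) p else 0) +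
      (if a = 2 * n + 1 - p then avoidCount (n - 1) p else 0) +
      (if a ∈ Icc 3 (2 * n - 1 - p) then avoidCount (n - 2) p else 0) := by
  have hN : 0 < 2 * n := by omega
  have hcard : (univ : Finset (Fin (2 * n))).card = 2 * (n - 1 + 1) := by
    rw [card_univ, Fintype.card_fin]; omega
  set w : ℕ → Fin (2 * n) := fun j => vertex hN (a - 1 + j) with hw
  have hinj : a + p - 1 ≤ 2 * n → ∀ i < p, ∀ j < p, w i = w j → i = j := by
    intro h i hi j hj hij
    rw [hw] at hij
    have := (vertex_inj hN (by omega) (by omega)).1 hij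
    omega
  have hne : ∀ i j, i < 2 * n → j < 2 * n → i ≠ j → vertex hN i ≠ vertex hN j :=
    fun i j hi hj hij h => hij ((vertex_inj hN hi hj).1 h)
  by_cases h1 : a = 1
  · rw [if_pos h1, if_neg (by omega), if_neg (by simp; omega), add_zero, add_zero]
    rw [← card_chord_avoidsPath (V := univ) hcard (u := vertex hN p) (v := vertex hN (p + 1))
      (mem_univ _) (mem_univ _) (hne _ _ (by omega) (by omega) (by omega)) (w := w)
      (fun _ _ => mem_univ _) (hinj (by omega))
      (fun i hi => ⟨hne _ _ (by omega) (by omega) (by omega),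
        hne _ _ (by omega) (by omega) (by omega)⟩)]
    congr 2
    refine filter_congr fun f _ => ?_
    rw [isLCD_iff_fpfOn, IsBubble, forall_not_isShort_iff hN ha hp (by omega),
      show a + p - 1 + 1 = p + 1 by omega, isShort_iff hN (i := p + 1), Nat.add_sub_cancel]
    refine and_congr_right fun _ => ?_
    constructor
    · rintro ⟨-, -, -, h, -, h'⟩
      exact ⟨(h'.resolve_left (by omega)).2.2, h⟩
    · rintro ⟨h, h'⟩
      exact ⟨by omega, by omega, by omega, h', Or.inl h1, Or.inr ⟨by omega, by omega, h⟩⟩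
  by_cases h2 : a = 2 * n + 1 - p
  · rw [if_neg h1, if_pos h2, if_neg (by simp; omega), add_zero, zero_add]
    rw [← card_chord_avoidsPath (V := univ) hcard (u := vertex hN (a - 2 - 1))
      (v := vertex hN (a - 2))
      (mem_univ _) (mem_univ _) (hne _ _ (by omega) (by omega) (by omega)) (w := w)
      (fun _ _ => mem_univ _) (hinj (by omega))
      (fun i hi => ⟨hne _ _ (by omega) (by omega) (by omega),
        hne _ _ (by omega) (by omega) (by omega)⟩)]
    congr 2
    refine filter_congr fun f _ => ?_
    rw [isLCD_iff_fpfOn, IsBubble, forall_not_isShort_iff hN ha hp (by omega), isShort_iff hN]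
    refine and_congr_right fun _ => ?_
    constructor
    · rintro ⟨-, -, -, h, h', -⟩
      exact ⟨(h'.resolve_left h1).2.2, h⟩
    · rintro ⟨h, h'⟩
      exact ⟨by omega, by omega, by omega, h', Or.inr ⟨by omega, by omega, h⟩, Or.inl (by omega)⟩
  by_cases h3 : a ∈ Icc 3 (2 * n - 1 - p)
  · rw [if_neg h1, if_neg h2, if_pos h3, zero_add, zero_add]
    rw [mem_Icc] at h3
    have hu := hne (a - 2 - 1) (a - 2) (by omega) (by omega) (by omega)
    have hv := hne (a + p - 1) (a + p) (by omega) (by omega) (by omega)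
    have d1 := hne (a + p - 1) (a - 2 - 1) (by omega) (by omega) (by omega)
    have d2 := hne (a + p - 1) (a - 2) (by omega) (by omega) (by omega)
    have d3 := hne (a + p) (a - 2 - 1) (by omega) (by omega) (by omega)
    have d4 := hne (a + p) (a - 2) (by omega) (by omega) (by omega)
    have dw : ∀ i < p, w i ≠ vertex hN (a - 2 - 1) ∧ w i ≠ vertex hN (a - 2) := fun i hi =>
      ⟨hne _ _ (by omega) (by omega) (by omega), hne _ _ (by omega) (by omega) (by omega)⟩
    have dw' : ∀ i < p, w i ≠ vertex hN (a + p - 1) ∧ w i ≠ vertex hN (a + p) := fun i hi =>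
      ⟨hne _ _ (by omega) (by omega) (by omega), hne _ _ (by omega) (by omega) (by omega)⟩
    have hcard' := card_sdiff_pair (mem_univ _) (mem_univ _) hu hcard
    rw [show n - 1 = n - 2 + 1 by omega] at hcard'
    rw [← card_chord_avoidsPath hcard' (u := vertex hN (a + p - 1)) (v := vertex hN (a + p))
      (by simp [d1, d2]) (by simp [d3, d4]) hv (w := w) (fun i hi => by simp [dw i hi])
      (hinj (by omega)) dw']
    have hremove := card_fpfOn_remove
      (P := fun f => f (vertex hN (a + p - 1)) = vertex hN (a + p) ∧ AvoidsPath w p f)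
      (Q := fun f => f (vertex hN (a + p - 1)) = vertex hN (a + p) ∧ AvoidsPath w p f)
      (mem_univ _) (mem_univ _) hu (fun f hf hfu => by
        rw [AvoidsPath.swap_comp_iff hf hfu dw, Function.comp_apply, hf.swap_apply hfu d1 d2])
    trans ((#{f | FpfOn univ f ∧ f (vertex hN (a - 2 - 1)) = vertex hN (a - 2) ∧
      f (vertex hN (a + p - 1)) = vertex hN (a + p) ∧ AvoidsPath w p f} : ℕ) : ℤ)
    swap
    · congr 1
      convert hremove
    congr 2
    refine filter_congr fun f _ => ?_
    rw [isLCD_iff_fpfOn, IsBubble, forall_not_isShort_iff hN ha hp (by omega), isShort_iff hN,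
      isShort_iff hN, show a + p - 1 + 1 = a + p by omega]
    refine and_congr_right fun _ => ?_
    constructor
    · rintro ⟨-, -, -, h, h', h''⟩
      exact ⟨(h'.resolve_left h1).2.2, (h''.resolve_left (by omega)).2.2, h⟩
    · rintro ⟨h, h', h''⟩
      exact ⟨by omega, by omega, by omega, h'', Or.inr ⟨by omega, by omega, h⟩,
        Or.inr ⟨by omega, by omega, h'⟩⟩
  · rw [if_neg h1, if_neg h2, if_neg h3]
    rw [mem_Icc] at h3
    simp only [add_zero, Nat.cast_eq_zero, card_eq_zero, filter_eq_empty_iff]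
    rintro f - ⟨-, -, -, hb, -, hl, hr⟩
    rw [isShort_iff hN] at hl hr
    omega

/-- `B n p` in terms of matchings avoiding the edges of a path: the two summands count the
bubbles at an end of the diagram and those enclosed by two short chords. -/
lemma B_eq {n p : ℕ} (hp : 1 ≤ p) (hpn : p ≤ 2 * n - 2) :
    (B n p : ℤ) = 2 * avoidCount (n - 1) p + ((2 * n - 3 - p : ℕ) : ℤ) * avoidCount (n - 2) p := by
  classical
  have hB : B n p = ∑ a ∈ Icc 1 (2 * n), #{f | IsLCD n f ∧ IsBubble n f a (a + p - 1)} := by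
    rw [B, card_eq_sum_card_fiberwise (f := fun x => x.2.1) (t := Icc 1 (2 * n))]
    · refine sum_congr rfl fun a ha => ?_
      rw [mem_Icc] at ha
      refine card_bij' (fun x _ => x.1) (fun f _ => (f, a, a + p - 1)) ?_ ?_ ?_ ?_
      · rintro ⟨f, a', b⟩ h
        simp only [mem_filter, mem_product, mem_univ, true_and, mem_Icc] at h ⊢
        obtain ⟨⟨h1, h2, h3, h4⟩, rfl⟩ := h
        have := h3.2.1
        rw [show a' + p - 1 = b by omega]
        exact ⟨h2, h3⟩
      · intro f h
        simp only [mem_filter, mem_product, mem_univ, true_and, mem_Icc] at h ⊢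
        have := h.2.2.2.1
        exact ⟨⟨⟨ha, by omega, by omega⟩, h.1, h.2, by omega⟩, trivial⟩
      · rintro ⟨f, a', b⟩ h
        simp only [mem_filter, mem_product, mem_univ, true_and, mem_Icc] at h
        obtain ⟨⟨h1, h2, h3, h4⟩, rfl⟩ := h
        have := h3.2.1
        simp only [Prod.mk.injEq, true_and]
        omega
      · intro f _; rfl
    · rintro ⟨f, a, b⟩ h
      simp only [coe_filter, mem_product, mem_univ, true_and, Set.mem_ofPred_eq] at h
      exact h.1.1
  rw [hB, Nat.cast_sum, sum_congr rfl fun a ha => card_isBubble hp hpn (mem_Icc.1 ha).1,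
    sum_add_distrib, sum_add_distrib, sum_ite_eq', sum_ite_eq', if_pos (by simp; omega),
    if_pos (by simp; omega), ← sum_filter, sum_const, nsmul_eq_mul, filter_mem_eq_inter,
    inter_eq_right.2 (Icc_subset_Icc (by omega) (by omega)), Nat.card_Icc,
    show 2 * n - 1 - p + 1 - 3 = 2 * n - 3 - p by omega]
  ring

end Bubbles

section Asymptotics

open Filter Topology

lemma matchCount_pos (k : ℕ) : 0 < matchCount k := prod_pos fun _ _ => by omega

lemma matchCount_succ (k : ℕ) : matchCount (k + 1) = matchCount k * (2 * k + 1) :=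
  prod_range_succ _ _

lemma matchCount_eq_mul_prod {k j : ℕ} (hj : j ≤ k) :
    matchCount k = matchCount (k - j) * ∏ i ∈ range j, (2 * k - 1 - 2 * i) := by
  induction j with
  | zero => simp
  | succ j ih =>
    rw [ih (by omega), prod_range_succ, show k - j = k - (j + 1) + 1 by omega, matchCount_succ,
      show 2 * (k - (j + 1)) + 1 = 2 * k - 1 - 2 * j by omega]
    ring

lemma avoidCount_eq_sum (p : ℕ) : ∀ k N : ℕ, p < N →
    avoidCount k p = ∑ j ∈ range N, (-1) ^ j * ((p - j).choose j * matchCount (k - j) : ℤ) := by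
  induction p using Nat.twoStepInduction with
  | zero =>
    intro k N hN
    obtain ⟨N, rfl⟩ : ∃ M, N = M + 1 := ⟨N - 1, by omega⟩
    rw [sum_range_succ', sum_eq_zero]
    · simp [avoidCount]
    · intro i _; simp
  | one =>
    intro k N hN
    obtain ⟨N, rfl⟩ : ∃ M, N = M + 1 := ⟨N - 1, by omega⟩
    rw [sum_range_succ', sum_eq_zero]
    · simp [avoidCount]
    · intro i _; simp
  | more p ih0 ih1 =>
    intro k N hN
    obtain ⟨N, rfl⟩ : ∃ M, N = M + 1 := ⟨N - 1, by omega⟩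
    rw [avoidCount, ih1 k (N + 1) (by omega), ih0 (k - 1) N (by omega), sum_range_succ',
      sum_range_succ', add_sub_right_comm, ← sum_sub_distrib]
    congr 1
    · refine sum_congr rfl fun i _ => ?_
      rw [show k - (i + 1) = k - 1 - i by omega, show p + 1 - (i + 1) = p - i by omega,
        show p + 2 - (i + 1) = p + 1 - i by omega]
      have : (p + 1 - i).choose (i + 1) = (p - i).choose i + (p - i).choose (i + 1) := by
        rcases Nat.lt_or_ge p i with h | h
        · rw [show p + 1 - i = 0 by omega, show p - i = 0 by omega]
          obtain ⟨i, rfl⟩ : ∃ l, i = l + 1 := ⟨i - 1, by omega⟩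
          simp
        · rw [show p + 1 - i = p - i + 1 by omega, Nat.choose_succ_succ]
      rw [this]
      push_cast
      ring

lemma choose_mul_matchCount_div {k p : ℕ} (hp : p ≤ 2 * k) (j : ℕ) :
    ((p - j).choose j * matchCount (k - j) : ℝ) / matchCount k =
      (∏ i ∈ range j, ((p - (j + i) : ℕ) : ℝ) / ((2 * k - (1 + 2 * i) : ℕ) : ℝ)) /
        (j.factorial : ℝ) := by
  have hf : (j.factorial : ℝ) ≠ 0 := by positivity
  have hd : (∏ i ∈ range j, ((p - (j + i) : ℕ) : ℝ)) = j.factorial * (p - j).choose j := by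
    rw [← Nat.cast_mul, ← Nat.descFactorial_eq_factorial_mul_choose,
      Nat.descFactorial_eq_prod_range, Nat.cast_prod]
    simp only [Nat.sub_add_eq]
  rw [prod_div_distrib, hd]
  rcases Nat.lt_or_ge k j with h | h
  · simp [Nat.choose_eq_zero_of_lt (show p - j < j by omega)]
  · have h1 := matchCount_eq_mul_prod h
    have h2 : (0 : ℝ) < matchCount k := mod_cast matchCount_pos k
    rw [h1, Nat.cast_mul, Nat.cast_prod] at h2 ⊢
    simp only [Nat.sub_add_eq]
    have h3 : (0 : ℝ) < matchCount (k - j) := mod_cast matchCount_pos _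
    have h4 := (pos_iff_pos_of_mul_pos h2).1 h3
    field_simp

/-- A bounded perturbation of the numerator does not affect the limit of `b / K`. -/
lemma tendsto_div_of_abs_sub_le {a b K : ℕ → ℝ} {t c : ℝ} (hK : Tendsto K atTop atTop)
    (hb : Tendsto (fun n => b n / K n) atTop (𝓝 t)) (h : ∀ᶠ n in atTop, |a n - b n| ≤ c) :
    Tendsto (fun n => a n / K n) atTop (𝓝 t) := by
  have h0 : Tendsto (fun n => (a n - b n) / K n) atTop (𝓝 0) := by
    refine squeeze_zero_norm' ?_ (tendsto_const_nhds.div_atTop hK : Tendsto (fun n => c / K n) _ _)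
    filter_upwards [h, hK.eventually_gt_atTop 0] with n hn hKn
    rw [Real.norm_eq_abs, abs_div, abs_of_pos hKn]
    gcongr
  have := hb.add h0
  simpa [← add_div] using this

lemma tendsto_div_self_of_atTop {K : ℕ → ℝ} (hK : Tendsto K atTop atTop) :
    Tendsto (fun n => K n / K n) atTop (𝓝 1) := by
  refine tendsto_const_nhds.congr' ?_
  filter_upwards [hK.eventually_gt_atTop 0] with n hn
  rw [div_self hn.ne']

lemma abs_natCast_sub_sub_le (p c : ℕ) : |((p - c : ℕ) : ℝ) - p| ≤ c := by
  rcases le_total c p with h | h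
  · rw [Nat.cast_sub h]; simp
  · rw [Nat.sub_eq_zero_of_le h]
    simpa using h

lemma tendsto_natCast_sub_div_sub {p K : ℕ → ℕ} {t : ℝ} (hK : Tendsto K atTop atTop)
    (ht : Tendsto (fun n => (p n : ℝ) / (K n : ℝ)) atTop (𝓝 t)) (c d : ℕ) :
    Tendsto (fun n => ((p n - c : ℕ) : ℝ) / ((K n - d : ℕ) : ℝ)) atTop (𝓝 t) := by
  have hK' : Tendsto (fun n => (K n : ℝ)) atTop atTop := tendsto_natCast_atTop_atTop.comp hK
  have h1 := tendsto_div_of_abs_sub_le hK' ht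
    (Eventually.of_forall fun n => abs_natCast_sub_sub_le (p n) c)
  have h2 := tendsto_div_of_abs_sub_le hK' (tendsto_div_self_of_atTop hK')
    (Eventually.of_forall fun n => abs_natCast_sub_sub_le (K n) d)
  have h3 := h1.div h2 one_ne_zero
  rw [div_one] at h3
  refine h3.congr' ?_
  filter_upwards [hK'.eventually_gt_atTop 0] with n hn
  exact div_div_div_cancel_right₀ hn.ne' _ _

/-- The probability that a random matching of `2k` points avoids a path on `p ∼ 2kt` of them
tends to `exp (-t)`. -/
lemma tendsto_avoidCount_div {k p : ℕ → ℕ} {t : ℝ} (hk : Tendsto k atTop atTop)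
    (hp : ∀ᶠ n in atTop, p n ≤ 2 * k n)
    (ht : Tendsto (fun n => (p n : ℝ) / ((2 * k n : ℕ) : ℝ)) atTop (𝓝 t)) :
    Tendsto (fun n => (avoidCount (k n) (p n) : ℝ) / (matchCount (k n) : ℝ)) atTop
      (𝓝 (Real.exp (-t))) := by
  have hK : Tendsto (fun n => 2 * k n) atTop atTop := hk.const_mul_atTop' two_pos
  have hexp : Real.exp (-t) = ∑' j : ℕ, (-1) ^ j * (t ^ j / (j.factorial : ℝ)) := by
    rw [Real.exp_eq_exp_ℝ, NormedSpace.exp_eq_tsum_div]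
    refine tsum_congr fun j => ?_
    rw [neg_pow, mul_div_assoc]
  have hsum : ∀ n, (avoidCount (k n) (p n) : ℝ) / (matchCount (k n) : ℝ) =
      ∑' j : ℕ, (-1) ^ j * (((p n - j).choose j * matchCount (k n - j) : ℝ) /
        matchCount (k n)) := by
    intro n
    rw [tsum_eq_sum (s := range (p n + 1)), avoidCount_eq_sum (p n) (k n) _ (Nat.lt_succ_self _)]
    · push_cast
      rw [sum_div]
      exact sum_congr rfl fun j _ => mul_div_assoc _ _ _
    · intro j hj
      rw [Nat.choose_eq_zero_of_lt (by simp at hj; omega)]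
      simp
  rw [hexp]
  simp only [hsum]
  refine tendsto_tsum_of_dominated_convergence (bound := fun j => (1 : ℝ) ^ j / j.factorial)
    (Real.summable_pow_div_factorial 1) (fun j => ?_) ?_
  · refine Tendsto.const_mul _ ?_
    have h1 : Tendsto (fun n => (∏ i ∈ range j, ((p n - (j + i) : ℕ) : ℝ) /
        ((2 * k n - (1 + 2 * i) : ℕ) : ℝ)) / (j.factorial : ℝ)) atTop
        (𝓝 ((∏ _i ∈ range j, t) / (j.factorial : ℝ))) :=
      (tendsto_finsetProd _ fun i _ => tendsto_natCast_sub_div_sub hK ht _ _).div_const _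
    rw [prod_const, card_range] at h1
    refine h1.congr' ?_
    filter_upwards [hp] with n hn
    rw [choose_mul_matchCount_div hn]
  · filter_upwards [hp] with n hn j
    rw [choose_mul_matchCount_div hn, norm_mul, norm_pow, norm_neg, norm_one, one_pow, one_mul,
      Real.norm_of_nonneg (by positivity)]
    gcongr
    refine prod_le_one (fun _ _ => by positivity) fun i hi => ?_
    rw [mem_range] at hi
    refine div_le_one_of_le₀ (Nat.cast_le.2 (by omega)) (by positivity)

lemma sum_avoidCount (k m : ℕ) :
    ∑ q ∈ range m, avoidCount k (q + 1) = avoidCount (k + 1) 2 - avoidCount (k + 1) (m + 2) := by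
  induction m with
  | zero => simp
  | succ m ih =>
    rw [sum_range_succ, ih, avoidCount.eq_3 (k + 1) (m + 1), Nat.add_sub_cancel]
    ring

lemma sum_sub_mul_avoidCount (k m : ℕ) :
    ∑ q ∈ range m, ((m - q : ℕ) : ℤ) * avoidCount k (q + 1) =
      m * avoidCount (k + 1) 2 - avoidCount (k + 2) 4 + avoidCount (k + 2) (m + 4) := by
  induction m with
  | zero => simp
  | succ m ih =>
    have h : ∑ q ∈ range (m + 1), ((m + 1 - q : ℕ) : ℤ) * avoidCount k (q + 1) =
        ∑ q ∈ range (m + 1), ((m - q : ℕ) : ℤ) * avoidCount k (q + 1) +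
          ∑ q ∈ range (m + 1), avoidCount k (q + 1) := by
      rw [← sum_add_distrib]
      refine sum_congr rfl fun q hq => ?_
      rw [Nat.succ_sub (by simp at hq; omega)]
      push_cast
      ring
    rw [h, sum_avoidCount, sum_range_succ, ih, avoidCount.eq_3 (k + 2) (m + 3)]
    simp only [Nat.sub_self, Nat.add_one_sub_one, Nat.cast_zero, zero_mul]
    push_cast
    ring

/-- The total number of bubbles other than entire diagrams. -/
lemma sum_B_eq (k : ℕ) :
    ((∑ p ∈ Icc 1 (2 * (k + 2) - 2), B (k + 2) p : ℕ) : ℤ) =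
      2 * avoidCount (k + 2) 2 - avoidCount (k + 2) (2 * (k + 2)) +
        2 * k * avoidCount (k + 1) 2 - avoidCount (k + 2) 4 := by
  rw [Nat.cast_sum, ← Ico_add_one_right_eq_Icc, sum_Ico_eq_sum_range,
    show 2 * (k + 2) - 2 + 1 - 1 = 2 * k + 2 by omega]
  have h : ∀ q ∈ range (2 * k + 2), (B (k + 2) (1 + q) : ℤ) =
      2 * avoidCount (k + 1) (q + 1) + ((2 * k - q : ℕ) : ℤ) * avoidCount k (q + 1) := by
    intro q hq
    rw [mem_range] at hq
    rw [B_eq (by omega) (by omega), add_comm 1 q,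
      show 2 * (k + 2) - 3 - (q + 1) = 2 * k - q by omega]
    rfl
  rw [sum_congr rfl h, sum_add_distrib, ← mul_sum, sum_avoidCount, sum_range_succ, sum_range_succ,
    sum_sub_mul_avoidCount]
  simp only [Nat.sub_self, Nat.cast_zero, zero_mul, add_zero,
    Nat.sub_eq_zero_of_le (Nat.le_succ (2 * k))]
  push_cast
  rw [show 2 * (k + 2) = 2 * k + 4 by ring]
  ring

lemma tendsto_two_mul_add_div (c d : ℝ) :
    Tendsto (fun k : ℕ => (2 * (k : ℝ) + c) / (2 * (k : ℝ) + d)) atTop (𝓝 1) := by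
  have hK : Tendsto (fun k : ℕ => 2 * (k : ℝ) + d) atTop atTop :=
    tendsto_atTop_add_const_right _ _ (tendsto_natCast_atTop_atTop.const_mul_atTop two_pos)
  refine tendsto_div_of_abs_sub_le (c := |c - d|) hK (tendsto_div_self_of_atTop hK)
    (Eventually.of_forall fun k => le_of_eq ?_)
  congr 1
  ring

lemma tendsto_avoidCount_const_div (c l : ℕ) :
    Tendsto (fun k : ℕ => (avoidCount (k + l) c : ℝ) / (matchCount (k + l) : ℝ)) atTop (𝓝 1) := by
  have h := tendsto_avoidCount_div (k := fun k => k + l) (p := fun _ => c) (t := 0)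
    (tendsto_add_atTop_nat l) ?_ ?_
  · simpa using h
  · filter_upwards [eventually_ge_atTop c] with k hk
    omega
  · refine tendsto_const_nhds.div_atTop (tendsto_natCast_atTop_atTop.comp ?_)
    exact (tendsto_add_atTop_nat l).const_mul_atTop' two_pos

/-- On average a random diagram has asymptotically `2 - 1/e` bubbles other than itself. -/
lemma tendsto_sum_B_div :
    Tendsto (fun k : ℕ => ((∑ p ∈ Icc 1 (2 * (k + 2) - 2), B (k + 2) p : ℕ) : ℝ) /
      (matchCount (k + 2) : ℝ)) atTop (𝓝 (2 - Real.exp (-1))) := by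
  have h1 : Tendsto (fun k : ℕ => (avoidCount (k + 2) (2 * (k + 2)) : ℝ) /
      (matchCount (k + 2) : ℝ)) atTop (𝓝 (Real.exp (-1))) :=
    tendsto_avoidCount_div (k := fun k => k + 2) (p := fun k => 2 * (k + 2))
      (tendsto_add_atTop_nat 2) (Eventually.of_forall fun _ => le_rfl)
      (tendsto_div_self_of_atTop (tendsto_natCast_atTop_atTop.comp
        ((tendsto_add_atTop_nat 2).const_mul_atTop' two_pos)))
  have h2 := (((tendsto_avoidCount_const_div 2 2).const_mul 2).sub h1).add
    ((tendsto_two_mul_add_div 0 3).mul (tendsto_avoidCount_const_div 2 1)) |>.sub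
    (tendsto_avoidCount_const_div 4 2)
  rw [show 2 * 1 - Real.exp (-1) + 1 * 1 - 1 = 2 - Real.exp (-1) by ring] at h2
  refine h2.congr fun k => ?_
  have h3 := congrArg (Int.cast : ℤ → ℝ) (sum_B_eq k)
  rw [Int.cast_natCast] at h3
  rw [h3]
  have h4 : (matchCount (k + 2) : ℝ) = matchCount (k + 1) * (2 * k + 3) := by
    rw [matchCount_succ]; push_cast; ring
  have h5 : (0 : ℝ) < matchCount (k + 1) := mod_cast matchCount_pos _
  rw [h4]
  push_cast
  field_simp
  ring

/-- The expected number of bubbles of size `⌊x (n - 1)⌋`, rescaled by `n - 1`. -/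
lemma tendsto_mul_B_div {x : ℝ} (hx0 : 0 < x) (hx2 : x ≤ 2) :
    Tendsto (fun k : ℕ => ((k + 1 : ℕ) : ℝ) * (B (k + 2) ⌊x * ((k + 1 : ℕ) : ℝ)⌋₊ : ℝ) /
      (matchCount (k + 2) : ℝ)) atTop (𝓝 ((6 - x) * Real.exp (-x / 2) / 4)) := by
  set p : ℕ → ℕ := fun k => ⌊x * ((k + 1 : ℕ) : ℝ)⌋₊ with hp
  have hpx : Tendsto (fun k => (p k : ℝ) / ((k + 1 : ℕ) : ℝ)) atTop (𝓝 x) :=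
    (tendsto_nat_floor_mul_div_atTop hx0.le).comp
      (tendsto_natCast_atTop_atTop.comp (tendsto_add_atTop_nat 1))
  have hple : ∀ k, p k ≤ 2 * (k + 1) := fun k => by
    refine Nat.floor_le_of_le ?_
    push_cast
    gcongr
  have hK : ∀ d : ℝ, Tendsto (fun k : ℕ => 2 * (k : ℝ) + d) atTop atTop := fun d =>
    tendsto_atTop_add_const_right _ _ (tendsto_natCast_atTop_atTop.const_mul_atTop two_pos)
  have hpd : ∀ d : ℝ, Tendsto (fun k => (p k : ℝ) / (2 * (k : ℝ) + d)) atTop (𝓝 (x / 2)) := by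
    intro d
    have := (hpx.div_const 2).mul (tendsto_two_mul_add_div 2 d)
    rw [mul_one] at this
    refine this.congr fun k => ?_
    push_cast
    field_simp
  have h1 : Tendsto (fun k => (avoidCount (k + 1) (p k) : ℝ) / (matchCount (k + 1) : ℝ)) atTop
      (𝓝 (Real.exp (-(x / 2)))) := by
    refine tendsto_avoidCount_div (k := fun k => k + 1) (tendsto_add_atTop_nat 1)
      (Eventually.of_forall hple) ((hpd 2).congr fun k => ?_)
    push_cast
    ring
  have h2 : Tendsto (fun k => (avoidCount k (min (p k) (2 * k)) : ℝ) / (matchCount k : ℝ)) atTop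
      (𝓝 (Real.exp (-(x / 2)))) := by
    refine tendsto_avoidCount_div (k := fun k => k) tendsto_id
      (Eventually.of_forall fun k => min_le_right _ _) ?_
    have := tendsto_div_of_abs_sub_le (a := fun k => ((min (p k) (2 * k) : ℕ) : ℝ)) (c := 2)
      (hK 0) (hpd 0) (Eventually.of_forall fun k => ?_)
    · refine this.congr fun k => ?_
      push_cast
      ring
    · have h := hple k
      have h3 : p k ≤ min (p k) (2 * k) + 2 := by omega
      have h4 : min (p k) (2 * k) ≤ p k := min_le_left _ _
      rw [abs_le]
      constructor
      · have : (p k : ℝ) ≤ ((min (p k) (2 * k) : ℕ) : ℝ) + 2 := mod_cast h3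
        linarith
      · have : ((min (p k) (2 * k) : ℕ) : ℝ) ≤ p k := Nat.cast_le.2 h4
        linarith
  have h3 : Tendsto (fun k => ((2 * k + 1 - p k : ℕ) : ℝ) / (2 * (k : ℝ) + 1)) atTop
      (𝓝 (1 - x / 2)) := by
    have := (tendsto_div_self_of_atTop (hK 1)).sub (hpd 1)
    simp only [← sub_div] at this
    refine tendsto_div_of_abs_sub_le (c := 1) (hK 1) this (Eventually.of_forall fun k => ?_)
    have h := hple k
    rcases Nat.lt_or_ge (2 * k + 1) (p k) with h' | h'
    · obtain h' : p k = 2 * k + 2 := by omega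
      rw [h', Nat.sub_eq_zero_of_le (by omega)]
      push_cast
      rw [abs_le]
      constructor <;> linarith
    · rw [Nat.cast_sub h']
      push_cast
      simp
  have hr := tendsto_two_mul_add_div 2 3
  have h4 := (hr.mul h1).add (((hr.div_const 2).mul h3).mul h2)
  rw [show 1 * Real.exp (-(x / 2)) + 1 / 2 * (1 - x / 2) * Real.exp (-(x / 2)) =
    (6 - x) * Real.exp (-x / 2) / 4 by rw [neg_div]; ring] at h4
  refine h4.congr' ?_
  filter_upwards [hpx.eventually (lt_mem_nhds hx0)] with k hk
  have hp1 : 1 ≤ p k := by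
    rcases Nat.eq_zero_or_pos (p k) with h | h
    · simp [h] at hk
    · exact h
  have h5 := congrArg (Int.cast : ℤ → ℝ)
    (B_eq (n := k + 2) hp1 (by have := hple k; omega))
  have h6 : ((2 * k + 1 - p k : ℕ) : ℝ) * (avoidCount k (p k) : ℝ) =
      ((2 * k + 1 - p k : ℕ) : ℝ) * (avoidCount k (min (p k) (2 * k)) : ℝ) := by
    rcases Nat.lt_or_ge (2 * k) (p k) with h | h
    · simp [Nat.sub_eq_zero_of_le (show 2 * k + 1 ≤ p k by omega)]
    · rw [min_eq_left h]
  rw [show 2 * (k + 2) - 3 - p k = 2 * k + 1 - p k by omega, show k + 2 - 1 = k + 1 by omega,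
    Nat.add_sub_cancel, Int.cast_natCast, Int.cast_add, Int.cast_mul, Int.cast_mul,
    Int.cast_natCast, h6] at h5
  rw [h5]
  have h7 : (matchCount (k + 1) : ℝ) = matchCount k * (2 * k + 1) := by
    rw [matchCount_succ]; push_cast; ring
  have h8 : (matchCount (k + 2) : ℝ) = matchCount k * (2 * k + 1) * (2 * k + 3) := by
    rw [matchCount_succ, matchCount_succ]; push_cast; ring
  have h9 : (0 : ℝ) < matchCount k := mod_cast matchCount_pos _
  rw [h7, h8]
  push_cast
  field_simp

end Asymptotics

/-- Asymptotic distribution of bubble sizes: for `0 < x ≤ 2`, the rescaled counts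
`(n-1)·B_{n,⌊x(n-1)⌋} / ∑_{p=1}^{2n-2} B_{n,p}` converge to
`ρ(x) = e(6-x)e^{-x/2} / (2(4e-2))`. -/
theorem bubble_size_asymptotic_distribution (x : ℝ) (hx0 : 0 < x) (hx2 : x ≤ 2) :
    Filter.Tendsto (fun n : ℕ =>
      (((n-1) : ℕ) : ℝ) * ((B n ⌊x * (((n-1) : ℕ) : ℝ)⌋₊ : ℕ) : ℝ) /
        ((∑ p ∈ Finset.Icc 1 (2*n-2), B n p : ℕ) : ℝ))
      Filter.atTop
      (nhds (Real.exp 1 * (6 - x) * Real.exp (-x/2) / (2 * (4 * Real.exp 1 - 2)))) := by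
  rw [← Filter.tendsto_add_atTop_iff_nat 2]
  have h := (tendsto_mul_B_div hx0 hx2).div tendsto_sum_B_div (by
    have : Real.exp (-1) < 1 := Real.exp_lt_one_iff.2 (by norm_num)
    linarith)
  have hc : (6 - x) * Real.exp (-x / 2) / 4 / (2 - Real.exp (-1)) =
      Real.exp 1 * (6 - x) * Real.exp (-x / 2) / (2 * (4 * Real.exp 1 - 2)) := by
    have he : 1 < Real.exp 1 := Real.one_lt_exp_iff.2 one_pos
    have h1 : 2 - (Real.exp 1)⁻¹ = (2 * Real.exp 1 - 1) / Real.exp 1 := by field_simp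
    have h2 : 2 * Real.exp 1 - 1 ≠ 0 := by linarith
    have h3 : 2 * (4 * Real.exp 1 - 2) = 4 * (2 * Real.exp 1 - 1) := by ring
    rw [Real.exp_neg, h1, h3]
    field_simp
  rw [hc] at h
  refine h.congr fun k => ?_
  have : (matchCount (k + 2) : ℝ) ≠ 0 := mod_cast (matchCount_pos _).ne'
  exact div_div_div_cancel_right₀ this _ _
end

section
/- The mean size of bubbles of size at most 2n-2 is asymptotically (2-2e^{-1})/(2-e^{-1})·n: the sequence n ↦ (∑_{p=1}^{2n-2} p·B_{n,p}) / (n · ∑_{p=1}^{2n-2} B_{n,p}) tends to (2 - 2e^{-1})/(2 - e^{-1}) as n → ∞, where e is Euler's number. -/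
open Finset

section Counting

variable {α : Type*} [DecidableEq α]

/-- In a family of matchings that preserves `U` and is stable under relabelling `U` by
transpositions, each of the `#U - 1` possible partners of `x ∈ U` is equally likely. -/
theorem card_filter_apply_eq_mul (E : Finset (α → α)) (U : Finset α)
    (hE : ∀ f ∈ E, ∀ u ∈ U, f u ∈ U ∧ f u ≠ u)
    (hswap : ∀ f ∈ E, ∀ u ∈ U, ∀ v ∈ U, Equiv.swap u v ∘ f ∘ Equiv.swap u v ∈ E)
    {x y : α} (hx : x ∈ U) (hy : y ∈ U) (hxy : x ≠ y) :
    #{f ∈ E | f x = y} * (#U - 1) = #E := by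
  have hmaps : Set.MapsTo (fun f : α → α => f x) (E : Set (α → α)) (U.erase x) := by
    intro f hf
    have := hE f hf x hx
    simp [this.1, this.2]
  rw [Finset.card_eq_sum_card_fiberwise hmaps, ← Finset.card_erase_of_mem hx]
  have key : ∀ z ∈ U.erase x, #{f ∈ E | f x = z} = #{f ∈ E | f x = y} := by
    intro z hz
    obtain ⟨hzx, hzU⟩ := Finset.mem_erase.1 hz
    have hxfix : Equiv.swap y z x = x := Equiv.swap_apply_of_ne_of_ne hxy (Ne.symm hzx)
    have hinv : ∀ f : α → α,
        Equiv.swap y z ∘ (Equiv.swap y z ∘ f ∘ Equiv.swap y z) ∘ Equiv.swap y z = f := by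
      intro f; ext v; simp
    refine Finset.card_nbij' (fun f => Equiv.swap y z ∘ f ∘ Equiv.swap y z)
      (fun f => Equiv.swap y z ∘ f ∘ Equiv.swap y z) ?_ ?_ ?_ ?_
    · intro f hf
      simp only [coe_filter, Set.mem_ofPred_eq] at hf ⊢
      exact ⟨hswap f hf.1 y hy z hzU, by simp [hxfix, hf.2]⟩
    · intro f hf
      simp only [coe_filter, Set.mem_ofPred_eq] at hf ⊢
      exact ⟨hswap f hf.1 y hy z hzU, by simp [hxfix, hf.2]⟩
    · intro f _
      exact hinv f
    · intro f _
      exact hinv f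
  rw [Finset.sum_congr rfl key, Finset.sum_const, smul_eq_mul, mul_comm]

end Counting

open scoped Classical in
/-- The linear chord diagrams on `2n` vertices in which every `i ∈ S` starts a short chord. -/
noncomputable def diagramsWithShort (n : ℕ) (S : Finset ℕ) :
    Finset (Fin (2*n) → Fin (2*n)) :=
  univ.filter (fun f => IsLCD n f ∧ ∀ i ∈ S, IsShort n f i)

/-- The vertices not covered by the short chords starting at the elements of `S`. -/
def freeVertices (n : ℕ) (S : Finset ℕ) : Finset (Fin (2*n)) :=
  univ.filter (fun v => (v : ℕ) + 1 ∉ S ∧ (v : ℕ) ∉ S)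

theorem mem_diagramsWithShort {n : ℕ} {S : Finset ℕ} {f : Fin (2*n) → Fin (2*n)} :
    f ∈ diagramsWithShort n S ↔ IsLCD n f ∧ ∀ i ∈ S, IsShort n f i := by
  simp [diagramsWithShort]

theorem mem_freeVertices {n : ℕ} {S : Finset ℕ} {v : Fin (2*n)} :
    v ∈ freeVertices n S ↔ (v : ℕ) + 1 ∉ S ∧ (v : ℕ) ∉ S := by
  simp [freeVertices]

theorem IsShort.not_succ {n : ℕ} {f : Fin (2*n) → Fin (2*n)} (hf : IsLCD n f) {i : ℕ}
    (h : IsShort n f i) : ¬ IsShort n f (i + 1) := by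
  rintro ⟨_, h2, h3⟩
  obtain ⟨h1, h4, h5⟩ := h
  have h6 := (hf ⟨i - 1, by omega⟩).1
  rw [h5] at h6
  have h7 : f ⟨i, h4⟩ = ⟨i + 1, h2⟩ := h3
  rw [h6] at h7
  have := congrArg Fin.val h7
  simp at this

theorem card_freeVertices {n : ℕ} (S : Finset ℕ) (hS : S ⊆ Icc 1 (2*n-1))
    (hS' : ∀ i ∈ S, i + 1 ∉ S) : #(freeVertices n S) + 2 * #S = 2 * n := by
  have h1 : (freeVertices n S).map Fin.valEmbedding
      = range (2*n) \ (S ∪ S.image (fun i => i - 1)) := by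
    ext v
    simp only [mem_map, mem_freeVertices, Fin.valEmbedding_apply, mem_sdiff, mem_range,
      mem_union, mem_image, not_or, not_exists, not_and]
    constructor
    · rintro ⟨w, ⟨hw1, hw2⟩, rfl⟩
      refine ⟨w.2, hw2, fun i hi h => hw1 ?_⟩
      have := mem_Icc.1 (hS hi)
      rwa [← h, Nat.sub_add_cancel this.1]
    · rintro ⟨hv, h1, h2⟩
      exact ⟨⟨v, hv⟩, ⟨fun h => h2 _ h (by simp), h1⟩, rfl⟩
  have h2 : Disjoint S (S.image (fun i => i - 1)) := by
    rw [Finset.disjoint_left]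
    intro i hi h
    obtain ⟨j, hj, rfl⟩ := mem_image.1 h
    have := mem_Icc.1 (hS hj)
    exact hS' _ hi (by rwa [Nat.sub_add_cancel this.1])
  have h3 : #(S.image (fun i => i - 1)) = #S := by
    apply Finset.card_image_of_injOn
    intro i hi j hj hij
    have h4 := mem_Icc.1 (hS hi)
    have h5 := mem_Icc.1 (hS hj)
    simp only at hij
    omega
  have h4 : S ∪ S.image (fun i => i - 1) ⊆ range (2*n) := by
    intro i hi
    rw [mem_range]
    rcases mem_union.1 hi with hi | hi
    · have := mem_Icc.1 (hS hi); omega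
    · obtain ⟨j, hj, rfl⟩ := mem_image.1 hi
      have := mem_Icc.1 (hS hj); omega
  have h5 := congrArg Finset.card h1
  rw [card_map, card_sdiff_of_subset h4, card_union_of_disjoint h2, h3, card_range] at h5
  have h6 := card_le_card h4
  rw [card_union_of_disjoint h2, h3, card_range] at h6
  omega

theorem diagramsWithShort_apply_mem {n : ℕ} {S : Finset ℕ} {f : Fin (2*n) → Fin (2*n)}
    (hf : f ∈ diagramsWithShort n S) {u : Fin (2*n)} (hu : u ∈ freeVertices n S) :
    f u ∈ freeVertices n S ∧ f u ≠ u := by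
  rw [mem_diagramsWithShort] at hf
  rw [mem_freeVertices] at hu ⊢
  refine ⟨⟨fun h => ?_, fun h => ?_⟩, (hf.1 u).2⟩
  · obtain ⟨h1, h2, h3⟩ := hf.2 _ h
    have h4 : (⟨(f u : ℕ) + 1 - 1, by omega⟩ : Fin (2*n)) = f u := by ext; simp
    rw [h4, (hf.1 u).1] at h3
    apply hu.2
    rw [h3]
    exact h
  · obtain ⟨h1, h2, h3⟩ := hf.2 _ h
    have h4 : (⟨(f u : ℕ), h2⟩ : Fin (2*n)) = f u := rfl
    have h5 := congrArg f h3
    rw [h4, (hf.1 u).1, (hf.1 _).1] at h5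
    apply hu.1
    rw [← h5]
    simpa [Nat.sub_add_cancel h1] using h

theorem diagramsWithShort_swap_mem {n : ℕ} {S : Finset ℕ} {f : Fin (2*n) → Fin (2*n)}
    (hf : f ∈ diagramsWithShort n S) {u v : Fin (2*n)} (hu : u ∈ freeVertices n S)
    (hv : v ∈ freeVertices n S) :
    Equiv.swap u v ∘ f ∘ Equiv.swap u v ∈ diagramsWithShort n S := by
  rw [mem_diagramsWithShort] at hf ⊢
  refine ⟨fun w => ⟨by simp [(hf.1 _).1], fun h => ?_⟩, fun i hi => ?_⟩
  · have h1 : f (Equiv.swap u v w) = Equiv.swap u v w := by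
      have := congrArg (Equiv.swap u v) h
      simpa using this
    exact (hf.1 _).2 h1
  · obtain ⟨h1, h2, h3⟩ := hf.2 i hi
    refine ⟨h1, h2, ?_⟩
    have key : ∀ w : Fin (2*n), w ∉ freeVertices n S → Equiv.swap u v w = w := by
      intro w hw
      exact Equiv.swap_apply_of_ne_of_ne (fun h => hw (h ▸ hu)) (fun h => hw (h ▸ hv))
    have h4 : Equiv.swap u v ⟨i - 1, by omega⟩ = ⟨i - 1, by omega⟩ := by
      apply key
      rw [mem_freeVertices]
      simp [Nat.sub_add_cancel h1, hi]
    have h5 : Equiv.swap u v ⟨i, h2⟩ = ⟨i, h2⟩ := by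
      apply key
      rw [mem_freeVertices]
      simp [hi]
    simp only [Function.comp_apply, h4, h3, h5]

theorem card_diagramsWithShort_insert {n : ℕ} {S : Finset ℕ} {i : ℕ} (hi : i ∉ S)
    (hS : insert i S ⊆ Icc 1 (2*n-1)) (hS' : ∀ j ∈ insert i S, j + 1 ∉ insert i S) :
    #(diagramsWithShort n (insert i S)) * (2 * n - 1 - 2 * #S) = #(diagramsWithShort n S) := by
  have hiI := mem_Icc.1 (hS (mem_insert_self i S))
  have h1 : i + 1 ∉ S := fun h => hS' i (mem_insert_self i S) (mem_insert_of_mem h)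
  have h2 : i - 1 ∉ S := by
    intro h
    refine hS' (i - 1) (mem_insert_of_mem h) ?_
    rw [Nat.sub_add_cancel hiI.1]
    exact mem_insert_self i S
  have hcard := card_freeVertices (n := n) S (fun j hj => hS (mem_insert_of_mem hj))
    (fun j hj h => hS' j (mem_insert_of_mem hj) (mem_insert_of_mem h))
  have hmain := card_filter_apply_eq_mul (diagramsWithShort n S) (freeVertices n S)
    (fun f hf u hu => diagramsWithShort_apply_mem hf hu)
    (fun f hf u hu v hv => diagramsWithShort_swap_mem hf hu hv)
    (x := ⟨i - 1, by omega⟩) (y := ⟨i, by omega⟩)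
    (by rw [mem_freeVertices]; simp [Nat.sub_add_cancel hiI.1, hi, h2])
    (by rw [mem_freeVertices]; simp [hi, h1])
    (by simp; omega)
  rw [← hmain]
  congr 1
  · congr 1
    ext f
    simp only [mem_filter, mem_diagramsWithShort, forall_mem_insert, and_assoc]
    refine and_congr_right fun _ => ?_
    rw [and_comm]
    refine and_congr_right fun _ => ?_
    exact ⟨fun ⟨_, _, h⟩ => h, fun h => ⟨hiI.1, by omega, h⟩⟩
  · omega

theorem card_diagramsWithShort_mul_prod {n : ℕ} (S : Finset ℕ) (hS : S ⊆ Icc 1 (2*n-1))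
    (hS' : ∀ j ∈ S, j + 1 ∉ S) :
    #(diagramsWithShort n S) * ∏ k ∈ range #S, (2 * n - 1 - 2 * k)
      = #(diagramsWithShort n ∅) := by
  induction S using Finset.induction_on with
  | empty => simp
  | insert i S hi ih =>
    rw [card_insert_of_notMem hi, prod_range_succ, mul_comm (∏ _ ∈ _, _), ← mul_assoc,
      card_diagramsWithShort_insert hi hS hS']
    exact ih (fun j hj => hS (mem_insert_of_mem hj))
      (fun j hj h => hS' j (mem_insert_of_mem hj) (mem_insert_of_mem h))

theorem card_diagramsWithShort_empty_pos (n : ℕ) : 0 < #(diagramsWithShort n ∅) := by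
  apply Finset.card_pos.2
  refine ⟨Fin.rev, mem_diagramsWithShort.2 ⟨fun i => ⟨Fin.rev_rev i, fun h => ?_⟩, by simp⟩⟩
  have := congrArg Fin.val h
  rw [Fin.val_rev] at this
  omega

/-- The `j`-element subsets of `{1,...,M}` without two consecutive elements. -/
def nonconsecutiveSets (M j : ℕ) : Finset (Finset ℕ) :=
  ((Icc 1 M).powersetCard j).filter (fun S => ∀ i ∈ S, i + 1 ∉ S)

theorem mem_nonconsecutiveSets {M j : ℕ} {S : Finset ℕ} :
    S ∈ nonconsecutiveSets M j ↔ (S ⊆ Icc 1 M ∧ #S = j) ∧ ∀ i ∈ S, i + 1 ∉ S := by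
  simp [nonconsecutiveSets, mem_powersetCard]

theorem card_nonconsecutiveSets_succ_succ (M j : ℕ) :
    #(nonconsecutiveSets (M + 2) (j + 1))
      = #(nonconsecutiveSets (M + 1) (j + 1)) + #(nonconsecutiveSets M j) := by
  rw [← Finset.card_filter_add_card_filter_not (s := nonconsecutiveSets (M + 2) (j + 1))
    (fun S => M + 2 ∉ S)]
  congr 1
  · congr 1
    ext S
    simp only [mem_filter, mem_nonconsecutiveSets]
    constructor
    · rintro ⟨⟨⟨h1, h2⟩, h3⟩, h4⟩
      refine ⟨⟨fun i hi => ?_, h2⟩, h3⟩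
      have h5 := mem_Icc.1 (h1 hi)
      have h6 : i ≠ M + 2 := fun h => h4 (h ▸ hi)
      exact mem_Icc.2 ⟨h5.1, by omega⟩
    · rintro ⟨⟨h1, h2⟩, h3⟩
      refine ⟨⟨⟨fun i hi => ?_, h2⟩, h3⟩, fun h => ?_⟩
      · have h5 := mem_Icc.1 (h1 hi)
        exact mem_Icc.2 ⟨h5.1, by omega⟩
      · have h5 := mem_Icc.1 (h1 h)
        omega
  · symm
    have hM : ∀ S ∈ nonconsecutiveSets M j, M + 2 ∉ S := by
      intro S hS h
      have := mem_Icc.1 ((mem_nonconsecutiveSets.1 hS).1.1 h)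
      omega
    refine Finset.card_nbij' (fun S => insert (M + 2) S) (fun S => S.erase (M + 2)) ?_ ?_ ?_ ?_
    · intro S hS
      have hMS := hM S hS
      obtain ⟨⟨h1, h2⟩, h3⟩ := mem_nonconsecutiveSets.1 hS
      simp only [coe_filter, Set.mem_ofPred_eq, mem_nonconsecutiveSets, not_not,
        mem_insert_self, and_true]
      refine ⟨⟨fun i hi => ?_, by rw [card_insert_of_notMem hMS, h2]⟩, fun i hi h => ?_⟩
      · rcases mem_insert.1 hi with rfl | hi
        · simp
        · have h5 := mem_Icc.1 (h1 hi)
          exact mem_Icc.2 ⟨h5.1, by omega⟩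
      · rcases mem_insert.1 hi with rfl | hi <;> rcases mem_insert.1 h with h | h
        · omega
        · have h5 := mem_Icc.1 (h1 h)
          omega
        · have h5 := mem_Icc.1 (h1 hi)
          omega
        · exact h3 i hi h
    · intro S hS
      simp only [coe_filter, Set.mem_ofPred_eq, mem_nonconsecutiveSets, not_not] at hS
      obtain ⟨⟨⟨h1, h2⟩, h3⟩, h4⟩ := hS
      refine mem_nonconsecutiveSets.2 ⟨⟨fun i hi => ?_, by rw [card_erase_of_mem h4, h2]; rfl⟩,
        fun i hi h => h3 i (mem_of_mem_erase hi) (mem_of_mem_erase h)⟩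
      have h5 := mem_Icc.1 (h1 (mem_of_mem_erase hi))
      have h6 := ne_of_mem_erase hi
      have h7 : i ≠ M + 1 := by
        rintro rfl
        exact h3 _ (mem_of_mem_erase hi) h4
      exact mem_Icc.2 ⟨h5.1, by omega⟩
    · intro S hS
      exact erase_insert (hM S hS)
    · intro S hS
      simp only [coe_filter, Set.mem_ofPred_eq, not_not] at hS
      exact insert_erase hS.2

theorem card_nonconsecutiveSets_zero (M : ℕ) : #(nonconsecutiveSets M 0) = 1 := by
  rw [card_eq_one]
  refine ⟨∅, ?_⟩
  ext S
  simp only [mem_nonconsecutiveSets, card_eq_zero, mem_singleton]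
  constructor
  · rintro ⟨⟨_, h⟩, _⟩
    exact h
  · rintro rfl
    simp

theorem card_nonconsecutiveSets (M j : ℕ) :
    #(nonconsecutiveSets M j) = (M + 1 - j).choose j := by
  induction M using Nat.twoStepInduction generalizing j with
  | zero =>
    cases j with
    | zero => simp [card_nonconsecutiveSets_zero]
    | succ j =>
      rw [Nat.choose_eq_zero_of_lt (by omega), card_eq_zero, eq_empty_iff_forall_notMem]
      intro S hS
      obtain ⟨⟨h1, h2⟩, _⟩ := mem_nonconsecutiveSets.1 hS
      have := card_le_card h1
      simp at this
      simp [this] at h2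
  | one =>
    rcases j with _ | _ | j
    · simp [card_nonconsecutiveSets_zero]
    · simp only [zero_add, Nat.reduceAdd, Nat.add_one_sub_one, Nat.choose_self]
      decide
    · rw [Nat.choose_eq_zero_of_lt (by omega), card_eq_zero, eq_empty_iff_forall_notMem]
      intro S hS
      obtain ⟨⟨h1, h2⟩, _⟩ := mem_nonconsecutiveSets.1 hS
      have := card_le_card h1
      simp at this
      omega
  | more M ih1 ih2 =>
    cases j with
    | zero => simp [card_nonconsecutiveSets_zero]
    | succ j =>
      rw [card_nonconsecutiveSets_succ_succ, ih1, ih2]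
      by_cases hj : j ≤ M + 1
      · have h1 : M + 2 + 1 - (j + 1) = (M + 1 - j) + 1 := by omega
        have h2 : M + 1 + 1 - (j + 1) = M + 1 - j := by omega
        rw [h1, h2, Nat.choose_succ_succ, add_comm]
      · rw [Nat.choose_eq_zero_of_lt (by omega), Nat.choose_eq_zero_of_lt (by omega),
          Nat.choose_eq_zero_of_lt (by omega)]

/-- The expected number of `j`-element sets of short chords in a uniformly random linear chord
diagram on `2n` vertices. -/
noncomputable def shortFactorialMoment (n j : ℕ) : ℝ :=
  ((2 * n - j).choose j : ℝ) / ((∏ k ∈ range j, (2 * n - 1 - 2 * k) : ℕ) : ℝ)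

theorem choose_sub_mul_factorial_le (n j : ℕ) (hj : j ≤ n) :
    j.factorial * (2 * n - j).choose j ≤ ∏ k ∈ range j, (2 * n - 1 - 2 * k) := by
  rw [← Nat.descFactorial_eq_factorial_mul_choose, Nat.descFactorial_eq_prod_range,
    ← prod_range_reflect, ← prod_range_reflect (fun k => 2 * n - 1 - 2 * k)]
  refine Finset.prod_le_prod' fun k hk => ?_
  have := mem_range.1 hk
  omega

theorem shortFactorialMoment_eq_zero {n j : ℕ} (hj : n < j) : shortFactorialMoment n j = 0 := by
  rw [shortFactorialMoment, Nat.choose_eq_zero_of_lt (by omega)]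
  simp

theorem shortFactorialMoment_nonneg (n j : ℕ) : 0 ≤ shortFactorialMoment n j := by
  unfold shortFactorialMoment
  positivity

theorem shortFactorialMoment_le (n j : ℕ) : shortFactorialMoment n j ≤ 1 / (j.factorial : ℝ) := by
  rcases lt_or_ge n j with hj | hj
  · rw [shortFactorialMoment_eq_zero hj]
    positivity
  · have h0 : 0 < ∏ k ∈ range j, (2 * n - 1 - 2 * k) := by
      refine Finset.prod_pos fun k hk => ?_
      have := mem_range.1 hk
      omega
    rw [shortFactorialMoment, div_le_div_iff₀ (by exact_mod_cast h0) (by positivity), one_mul,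
      mul_comm]
    exact_mod_cast choose_sub_mul_factorial_le n j hj

theorem tendsto_shortFactorialMoment (j : ℕ) :
    Filter.Tendsto (fun n => shortFactorialMoment n j) Filter.atTop
      (nhds (1 / (j.factorial : ℝ))) := by
  have h1 : ∀ n, j ≤ n → shortFactorialMoment n j
      = 1 / (j.factorial : ℝ) *
        ∏ k ∈ range j, ((2 * (n : ℝ) - (j + k)) / (2 * (n : ℝ) - (1 + 2 * k))) := by
    intro n hn
    have hd : ((2 * n - j).choose j : ℝ)
        = 1 / (j.factorial : ℝ) * ∏ k ∈ range j, (2 * (n : ℝ) - (j + k)) := by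
      have h2 := Nat.descFactorial_eq_factorial_mul_choose (2 * n - j) j
      rw [Nat.descFactorial_eq_prod_range] at h2
      have h3 : ((∏ k ∈ range j, (2 * n - j - k) : ℕ) : ℝ)
          = ∏ k ∈ range j, (2 * (n : ℝ) - (j + k)) := by
        rw [Nat.cast_prod]
        refine Finset.prod_congr rfl fun k hk => ?_
        have := mem_range.1 hk
        rw [Nat.sub_sub, Nat.cast_sub (by omega)]
        push_cast
        ring
      rw [← h3, h2]
      push_cast
      field_simp
    have he : ((∏ k ∈ range j, (2 * n - 1 - 2 * k) : ℕ) : ℝ)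
        = ∏ k ∈ range j, (2 * (n : ℝ) - (1 + 2 * k)) := by
      rw [Nat.cast_prod]
      refine Finset.prod_congr rfl fun k hk => ?_
      have := mem_range.1 hk
      rw [Nat.sub_sub, Nat.cast_sub (by omega)]
      push_cast
      ring
    rw [shortFactorialMoment, hd, he, Finset.prod_div_distrib, mul_div_assoc]
  have h2 : ∀ a b : ℝ, Filter.Tendsto (fun n : ℕ => (2 * (n : ℝ) - a) / (2 * (n : ℝ) - b))
      Filter.atTop (nhds 1) := by
    intro a b
    have h3 : ∀ c : ℝ, Filter.Tendsto (fun n : ℕ => 2 - c / (n : ℝ)) Filter.atTop (nhds 2) := by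
      intro c
      simpa using (tendsto_const_nhds (x := (2 : ℝ))).sub (tendsto_const_div_atTop_nhds_zero_nat c)
    have h4 := (h3 a).div (h3 b) two_ne_zero
    rw [div_self two_ne_zero] at h4
    refine h4.congr' ?_
    filter_upwards [Filter.eventually_gt_atTop 0] with n hn
    have hn' : (n : ℝ) ≠ 0 := by positivity
    simp only [Pi.div_apply]
    rw [← mul_div_mul_right (2 - a / (n : ℝ)) (2 - b / (n : ℝ)) hn']
    congr 1 <;> field_simp
  have h5 : Filter.Tendsto (fun n : ℕ => 1 / (j.factorial : ℝ) *
      ∏ k ∈ range j, ((2 * (n : ℝ) - (j + k)) / (2 * (n : ℝ) - (1 + 2 * k)))) Filter.atTop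
      (nhds (1 / (j.factorial : ℝ))) := by
    have := (tendsto_finsetProd (range j)
      (fun k _ => h2 ((j : ℝ) + k) (1 + 2 * (k : ℝ)))).const_mul (1 / (j.factorial : ℝ))
    simpa using this
  refine h5.congr' ?_
  filter_upwards [Filter.eventually_ge_atTop j] with n hn
  exact (h1 n hn).symm

theorem tendsto_tsum_shortFactorialMoment :
    Filter.Tendsto (fun n => ∑' j, (-1 : ℝ) ^ j * shortFactorialMoment n j) Filter.atTop
      (nhds (Real.exp 1)⁻¹) := by
  have hexp : (Real.exp 1)⁻¹ = ∑' j : ℕ, (-1 : ℝ) ^ j * (1 / (j.factorial : ℝ)) := by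
    rw [← Real.exp_neg, Real.exp_eq_exp_ℝ,
      ← (NormedSpace.expSeries_div_hasSum_exp (-1 : ℝ)).tsum_eq]
    exact tsum_congr fun j => by ring
  rw [hexp]
  refine tendsto_tsum_of_dominated_convergence (bound := fun j : ℕ => 1 / (j.factorial : ℝ))
    (by simpa using Real.summable_pow_div_factorial 1)
    (fun j => (tendsto_shortFactorialMoment j).const_mul _)
    (Filter.Eventually.of_forall fun n j => ?_)
  rw [norm_mul, norm_pow, norm_neg, norm_one, one_pow, one_mul,
    Real.norm_of_nonneg (shortFactorialMoment_nonneg n j)]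
  exact shortFactorialMoment_le n j

open scoped Classical in
/-- The set of (left endpoints of) short chords of `f`. -/
noncomputable def shorts (n : ℕ) (f : Fin (2*n) → Fin (2*n)) : Finset ℕ :=
  (Icc 1 (2*n-1)).filter (fun i => IsShort n f i)

theorem mem_shorts {n : ℕ} {f : Fin (2*n) → Fin (2*n)} {i : ℕ} :
    i ∈ shorts n f ↔ IsShort n f i := by
  simp only [shorts, mem_filter, mem_Icc, and_iff_right_iff_imp]
  rintro ⟨h1, h2, _⟩
  omega

theorem shorts_subset {n : ℕ} {f : Fin (2*n) → Fin (2*n)} : shorts n f ⊆ Icc 1 (2*n-1) := by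
  classical exact filter_subset _ _

theorem diagramsWithShort_eq_filter (n : ℕ) (S : Finset ℕ) :
    diagramsWithShort n S = (diagramsWithShort n ∅).filter (fun f => S ⊆ shorts n f) := by
  ext f
  simp [mem_diagramsWithShort, Finset.subset_iff, mem_shorts]

theorem card_diagramsWithShort_eq_div {n : ℕ} (S : Finset ℕ) (hS : S ⊆ Icc 1 (2*n-1))
    (hS' : ∀ j ∈ S, j + 1 ∉ S) :
    (#(diagramsWithShort n S) : ℝ) = #(diagramsWithShort n ∅)
      / ((∏ k ∈ range #S, (2 * n - 1 - 2 * k) : ℕ) : ℝ) := by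
  have h := card_diagramsWithShort_mul_prod S hS hS'
  have h0 : (∏ k ∈ range #S, (2 * n - 1 - 2 * k)) ≠ 0 := by
    intro h1
    rw [h1, mul_zero] at h
    exact (card_diagramsWithShort_empty_pos n).ne h
  rw [eq_div_iff (by exact_mod_cast h0)]
  exact_mod_cast h

theorem diagramsWithShort_eq_empty {n : ℕ} {S : Finset ℕ} (hS : ¬ ∀ j ∈ S, j + 1 ∉ S) :
    diagramsWithShort n S = ∅ := by
  push Not at hS
  obtain ⟨j, hj, hj'⟩ := hS
  rw [eq_empty_iff_forall_notMem]
  intro f hf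
  obtain ⟨h1, h2⟩ := mem_diagramsWithShort.1 hf
  exact (h2 j hj).not_succ h1 (h2 _ hj')

theorem sum_powersetCard_card_diagramsWithShort {n : ℕ} (hn : 1 ≤ n) (j : ℕ) :
    ∑ S ∈ powersetCard j (Icc 1 (2*n-1)), (#(diagramsWithShort n S) : ℝ)
      = #(diagramsWithShort n ∅) * shortFactorialMoment n j := by
  have h1 : ∑ S ∈ powersetCard j (Icc 1 (2*n-1)), (#(diagramsWithShort n S) : ℝ)
      = ∑ S ∈ nonconsecutiveSets (2*n-1) j, (#(diagramsWithShort n S) : ℝ) := by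
    rw [nonconsecutiveSets, Finset.sum_filter_of_ne]
    intro S _ hS
    by_contra h
    rw [diagramsWithShort_eq_empty h] at hS
    simp at hS
  have h2 : ∀ S ∈ nonconsecutiveSets (2*n-1) j, (#(diagramsWithShort n S) : ℝ)
      = #(diagramsWithShort n ∅) / ((∏ k ∈ range j, (2 * n - 1 - 2 * k) : ℕ) : ℝ) := by
    intro S hS
    obtain ⟨⟨hS1, rfl⟩, hS2⟩ := mem_nonconsecutiveSets.1 hS
    exact card_diagramsWithShort_eq_div S hS1 hS2
  rw [h1, Finset.sum_congr rfl h2, sum_const, card_nonconsecutiveSets, nsmul_eq_mul,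
    shortFactorialMoment, show 2 * n - 1 + 1 = 2 * n by omega]
  ring

theorem card_filter_shorts_eq_empty {n : ℕ} (hn : 1 ≤ n) :
    (#{f ∈ diagramsWithShort n ∅ | shorts n f = ∅} : ℝ)
      = #(diagramsWithShort n ∅) * ∑' j, (-1 : ℝ) ^ j * shortFactorialMoment n j := by
  have h1 : ∀ f : Fin (2*n) → Fin (2*n), (if shorts n f = ∅ then (1 : ℝ) else 0)
      = ∑ S ∈ (Icc 1 (2*n-1)).powerset, if S ⊆ shorts n f then (-1 : ℝ) ^ #S else 0 := by
    intro f
    have h2 := congrArg (Int.cast : ℤ → ℝ) (sum_powerset_neg_one_pow_card (x := shorts n f))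
    push_cast at h2
    rw [← h2, ← Finset.sum_filter]
    refine Finset.sum_congr ?_ fun _ _ => rfl
    ext S
    simp only [mem_powerset, mem_filter, iff_and_self]
    exact fun h => h.trans shorts_subset
  rw [Finset.card_filter, Nat.cast_sum]
  push_cast
  rw [Finset.sum_congr rfl fun f _ => h1 f, Finset.sum_comm, Finset.sum_powerset,
    tsum_eq_sum (s := range (#(Icc 1 (2*n-1)) + 1)), mul_sum]
  · refine Finset.sum_congr rfl fun j _ => ?_
    rw [mul_left_comm, ← sum_powersetCard_card_diagramsWithShort hn, mul_sum]
    refine Finset.sum_congr rfl fun S hS => ?_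
    rw [(mem_powersetCard.1 hS).2, ← Finset.sum_filter, sum_const, ← diagramsWithShort_eq_filter,
      nsmul_eq_mul, mul_comm]
  · intro j hj
    rw [shortFactorialMoment_eq_zero, mul_zero]
    simp at hj
    omega

theorem IsShort.bounds {n : ℕ} {f : Fin (2*n) → Fin (2*n)} {i : ℕ} (h : IsShort n f i) :
    1 ≤ i ∧ i < 2 * n := by
  obtain ⟨h1, h2, _⟩ := h
  exact ⟨h1, h2⟩

/-- Every vertex outside the short chords lies in a bubble. -/
theorem exists_isBubble {n : ℕ} {f : Fin (2*n) → Fin (2*n)} {v : ℕ} (hv1 : 1 ≤ v)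
    (hv2 : v ≤ 2 * n) (hv3 : ¬ IsShort n f v) (hv4 : ¬ IsShort n f (v - 1)) :
    ∃ a b, IsBubble n f a b ∧ a ≤ v ∧ v ≤ b := by
  classical
  have hR : ∃ b, v ≤ b ∧ (b = 2 * n ∨ IsShort n f (b + 1)) := ⟨2 * n, hv2, Or.inl rfl⟩
  obtain ⟨hb1, hb2⟩ := Nat.find_spec hR
  have hbmin : ∀ c, v ≤ c → (c = 2 * n ∨ IsShort n f (c + 1)) → Nat.find hR ≤ c :=
    fun c h1 h2 => Nat.find_min' hR ⟨h1, h2⟩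
  have hL : (fun a => a = 1 ∨ IsShort n f (a - 2)) 1 := Or.inl rfl
  have ha2 := Nat.findGreatest_spec (P := fun a => a = 1 ∨ IsShort n f (a - 2)) hv1 hL
  have ha1 := Nat.findGreatest_le (P := fun a => a = 1 ∨ IsShort n f (a - 2)) v
  have hamax : ∀ c, c ≤ v → (c = 1 ∨ IsShort n f (c - 2)) →
      c ≤ Nat.findGreatest (fun a => a = 1 ∨ IsShort n f (a - 2)) v :=
    fun c h1 h2 => Nat.le_findGreatest h1 h2
  have ha0 := hamax 1 hv1 (Or.inl rfl)
  generalize Nat.findGreatest (fun a => a = 1 ∨ IsShort n f (a - 2)) v = a at *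
  generalize Nat.find hR = b at *
  refine ⟨a, b, ⟨ha0, by omega, hbmin _ hv2 (Or.inl rfl), fun i hi1 hi2 hi => ?_, ha2, hb2⟩,
    ha1, hb1⟩
  have hib := hi.bounds
  rcases lt_trichotomy i v with h | rfl | h
  · by_cases h' : i = v - 1
    · exact hv4 (h' ▸ hi)
    · have := hamax (i + 2) (by omega) (Or.inr (by simpa using hi))
      omega
  · exact hv3 hi
  · have := hbmin (i - 1) (by omega) (Or.inr (by rwa [Nat.sub_add_cancel hib.1]))
    omega

theorem IsBubble.left_le {n : ℕ} {f : Fin (2*n) → Fin (2*n)} (hf : IsLCD n f) {a b a' b' v : ℕ}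
    (h : IsBubble n f a b) (h' : IsBubble n f a' b') (ha' : a' ≤ v) (hb : v ≤ b) :
    a' ≤ a := by
  obtain ⟨h1, h2, h3, h4, h5, h6⟩ := h
  obtain ⟨h1', h2', h3', h4', h5', h6'⟩ := h'
  by_contra! hlt
  rcases h5' with rfl | h5'
  · omega
  have hb' := h5'.bounds
  rcases Nat.lt_or_ge (a' - 2) a with hc | hc
  · rcases h5 with rfl | h5
    · omega
    · have := h5.bounds
      have h7 : a' - 2 = a - 2 + 1 := by omega
      exact h5.not_succ hf (h7 ▸ h5')
  · exact h4 _ hc (by omega) h5'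

theorem IsBubble.le_right {n : ℕ} {f : Fin (2*n) → Fin (2*n)} (hf : IsLCD n f) {a b a' b' v : ℕ}
    (h : IsBubble n f a b) (h' : IsBubble n f a' b') (hb' : v ≤ b') (ha : a ≤ v) :
    b ≤ b' := by
  obtain ⟨h1, h2, h3, h4, h5, h6⟩ := h
  obtain ⟨h1', h2', h3', h4', h5', h6'⟩ := h'
  by_contra! hlt
  rcases h6' with rfl | h6'
  · omega
  have hb'' := h6'.bounds
  rcases Nat.lt_or_ge b (b' + 2) with hc | hc
  · rcases h6 with rfl | h6
    · omega
    · have h7 : b + 1 = b' + 1 + 1 := by omega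
      exact h6'.not_succ hf (h7 ▸ h6)
  · exact h4 _ (by omega) (by omega) h6'

theorem IsBubble.eq_of_mem {n : ℕ} {f : Fin (2*n) → Fin (2*n)} (hf : IsLCD n f)
    {a b a' b' v : ℕ} (h : IsBubble n f a b) (h' : IsBubble n f a' b') (hv : a ≤ v ∧ v ≤ b)
    (hv' : a' ≤ v ∧ v ≤ b') : a = a' ∧ b = b' :=
  ⟨le_antisymm (h'.left_le hf h hv.1 hv'.2) (h.left_le hf h' hv'.1 hv.2),
    le_antisymm (h.le_right hf h' hv'.2 hv.1) (h'.le_right hf h hv.2 hv'.1)⟩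

open scoped Classical in
/-- The set of bubbles of `f`, as pairs of end points. -/
noncomputable def bubbles (n : ℕ) (f : Fin (2*n) → Fin (2*n)) : Finset (ℕ × ℕ) :=
  (Icc 1 (2*n) ×ˢ Icc 1 (2*n)).filter (fun β => IsBubble n f β.1 β.2)

theorem mem_bubbles {n : ℕ} {f : Fin (2*n) → Fin (2*n)} {β : ℕ × ℕ} :
    β ∈ bubbles n f ↔ IsBubble n f β.1 β.2 := by
  simp only [bubbles, mem_filter, mem_product, mem_Icc, and_iff_right_iff_imp]
  rintro ⟨h1, h2, h3, _⟩
  omega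

theorem sum_size_bubbles {n : ℕ} {f : Fin (2*n) → Fin (2*n)} (hf : IsLCD n f) :
    ∑ β ∈ bubbles n f, (β.2 - β.1 + 1) = #((bubbles n f).biUnion fun β => Icc β.1 β.2) := by
  rw [card_biUnion]
  · refine Finset.sum_congr rfl fun β hβ => ?_
    obtain ⟨h1, h2, h3, _⟩ := mem_bubbles.1 hβ
    rw [Nat.card_Icc]
    omega
  · intro β hβ β' hβ' hne
    refine Finset.disjoint_left.2 fun v hv hv' => hne ?_
    have := (mem_bubbles.1 hβ).eq_of_mem hf (mem_bubbles.1 hβ') (mem_Icc.1 hv) (mem_Icc.1 hv')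
    exact Prod.ext this.1 this.2

theorem sum_size_bubbles_le {n : ℕ} {f : Fin (2*n) → Fin (2*n)} (hf : IsLCD n f) :
    ∑ β ∈ bubbles n f, (β.2 - β.1 + 1) ≤ 2 * n := by
  rw [sum_size_bubbles hf]
  have h : ((bubbles n f).biUnion fun β => Icc β.1 β.2) ⊆ Icc 1 (2*n) := by
    refine biUnion_subset.2 fun β hβ => ?_
    obtain ⟨h1, h2, h3, _⟩ := mem_bubbles.1 hβ
    exact Icc_subset_Icc h1 h3
  simpa using card_le_card h

theorem le_sum_size_bubbles {n : ℕ} {f : Fin (2*n) → Fin (2*n)} (hf : IsLCD n f) :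
    2 * n ≤ ∑ β ∈ bubbles n f, (β.2 - β.1 + 1) + 2 * #(shorts n f) := by
  rw [sum_size_bubbles hf]
  have h : Icc 1 (2*n) ⊆ ((bubbles n f).biUnion fun β => Icc β.1 β.2) ∪
      (shorts n f ∪ (shorts n f).image (fun i => i + 1)) := by
    intro v hv
    rw [mem_Icc] at hv
    by_contra hc
    simp only [mem_union, not_or, mem_shorts, mem_image, not_exists, not_and] at hc
    obtain ⟨hc1, hc2, hc3⟩ := hc
    obtain ⟨a, b, hab, hav, hvb⟩ := exists_isBubble hv.1 hv.2 hc2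
      (fun h => hc3 _ h (Nat.sub_add_cancel hv.1))
    exact hc1 (mem_biUnion.2 ⟨(a, b), mem_bubbles.2 hab, mem_Icc.2 ⟨hav, hvb⟩⟩)
  have h1 := card_le_card h
  have h2 := card_union_le ((bubbles n f).biUnion fun β => Icc β.1 β.2)
    (shorts n f ∪ (shorts n f).image (fun i => i + 1))
  have h3 := card_union_le (shorts n f) ((shorts n f).image (fun i => i + 1))
  have h4 := card_image_le (s := shorts n f) (f := fun i => i + 1)
  simp only [Nat.card_Icc] at h1
  omega

/-- The possible left ends of bubbles: the first vertex and the vertices following a short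
chord. -/
noncomputable def gapStarts (n : ℕ) (f : Fin (2*n) → Fin (2*n)) : Finset ℕ :=
  insert 1 ((shorts n f).image (fun i => i + 2))

theorem card_gapStarts (n : ℕ) (f : Fin (2*n) → Fin (2*n)) :
    #(gapStarts n f) = #(shorts n f) + 1 := by
  rw [gapStarts, card_insert_of_notMem, card_image_of_injective]
  · intro i j h
    simpa using h
  · simp

theorem card_bubbles_le {n : ℕ} {f : Fin (2*n) → Fin (2*n)} (hf : IsLCD n f) :
    #(bubbles n f) ≤ #(shorts n f) + 1 := by
  rw [← card_gapStarts]
  refine card_le_card_of_injOn Prod.fst ?_ ?_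
  · intro β hβ
    obtain ⟨h1, h2, h3, h4, h5, h6⟩ := mem_bubbles.1 hβ
    simp only [gapStarts, coe_insert, coe_image, Set.mem_insert_iff, Set.mem_image, mem_coe,
      mem_shorts]
    refine h5.imp_right fun h => ⟨_, h, ?_⟩
    have := h.bounds
    omega
  · intro β hβ β' hβ' hab
    have h1 := mem_bubbles.1 hβ
    have h2 := mem_bubbles.1 hβ'
    have := h1.eq_of_mem hf h2 ⟨le_rfl, h1.2.1⟩ ⟨hab.ge, hab ▸ h2.2.1⟩
    exact Prod.ext this.1 this.2

/-- The number of empty gaps before, between and after the short chords. -/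
noncomputable def emptyGaps (n : ℕ) (f : Fin (2*n) → Fin (2*n)) : ℕ :=
  (if {1} ⊆ shorts n f then 1 else 0) + (if {2*n-1} ⊆ shorts n f then 1 else 0) +
    #{i ∈ Icc 1 (2*n-3) | {i, i + 2} ⊆ shorts n f}

theorem card_shorts_le {n : ℕ} (hn : 1 ≤ n) {f : Fin (2*n) → Fin (2*n)} (hf : IsLCD n f) :
    #(shorts n f) + 1 ≤ #(bubbles n f) + emptyGaps n f := by
  rw [← card_gapStarts]
  have h : gapStarts n f ⊆ (bubbles n f).image Prod.fst ∪
      ((if {1} ⊆ shorts n f then {1} else ∅) ∪ (if {2*n-1} ⊆ shorts n f then {2*n+1} else ∅) ∪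
      ({i ∈ Icc 1 (2*n-3) | {i, i + 2} ⊆ shorts n f}).image (fun i => i + 2)) := by
    intro a ha
    by_contra hc
    simp only [mem_union, not_or] at hc
    obtain ⟨hc1, ⟨hc2, hc3⟩, hc4⟩ := hc
    have ha1 : a = 1 ∨ IsShort n f (a - 2) := by
      simp only [gapStarts, mem_insert, mem_image, mem_shorts] at ha
      rcases ha with rfl | ⟨i, hi, rfl⟩
      · exact Or.inl rfl
      · exact Or.inr hi
    have hpos : 1 ≤ a := by
      rcases ha1 with rfl | h
      · exact le_rfl
      · have := h.bounds
        omega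
    have hprev : ¬ IsShort n f (a - 1) := by
      intro h
      have h1 := h.bounds
      rcases ha1 with rfl | h2
      · omega
      · have h3 := h2.bounds
        have h4 : a - 1 = a - 2 + 1 := by omega
        exact h2.not_succ hf (h4 ▸ h)
    have hself : ¬ IsShort n f a := by
      intro h
      have hb := h.bounds
      rcases ha1 with rfl | h2
      · simp [mem_shorts, h] at hc2
      · have h3 := h2.bounds
        apply hc4
        rw [mem_image]
        have h4 : a - 2 + 2 = a := by omega
        refine ⟨a - 2, mem_filter.2 ⟨mem_Icc.2 ⟨h3.1, by omega⟩, ?_⟩, h4⟩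
        rw [h4]
        simp [insert_subset_iff, mem_shorts, h, h2]
    have hle : a ≤ 2 * n := by
      by_contra! hgt
      rcases ha1 with rfl | h2
      · omega
      · have h3 := h2.bounds
        have h4 : a - 2 = 2 * n - 1 := by omega
        have h5 : a = 2 * n + 1 := by omega
        rw [h4] at h2
        simp [mem_shorts, h2, h5] at hc3
    obtain ⟨a', b, hab, ha', hb⟩ := exists_isBubble hpos hle hself hprev
    apply hc1
    have haa : a = a' := by
      refine le_antisymm ?_ ha'
      by_contra! hlt
      obtain ⟨h1, h2, h3, h4, h5, h6⟩ := hab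
      rcases ha1 with rfl | h7
      · omega
      · have h8 := h7.bounds
        rcases Nat.lt_or_ge (a - 2) a' with h9 | h9
        · rcases h5 with rfl | h5
          · omega
          · have h10 := h5.bounds
            have h11 : a - 2 = a' - 2 + 1 := by omega
            exact h5.not_succ hf (h11 ▸ h7)
        · exact h4 _ h9 (by omega) h7
    exact mem_image.2 ⟨(a', b), mem_bubbles.2 hab, haa.symm⟩
  refine (card_le_card h).trans ((card_union_le _ _).trans ?_)
  refine Nat.add_le_add card_image_le ((card_union_le _ _).trans ?_)
  refine Nat.add_le_add ((card_union_le _ _).trans ?_) card_image_le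
  refine Nat.add_le_add ?_ ?_ <;> split_ifs <;> simp

theorem IsBubble.size_le_iff {n : ℕ} (hn : 1 ≤ n) {f : Fin (2*n) → Fin (2*n)} {a b : ℕ}
    (h : IsBubble n f a b) : b - a + 1 ≤ 2 * n - 2 ↔ shorts n f ≠ ∅ := by
  obtain ⟨h1, h2, h3, h4, h5, h6⟩ := h
  constructor
  · rintro h7 h8
    have h9 : ∀ i, ¬ IsShort n f i := fun i hi => by
      have := mem_shorts.2 hi
      simp [h8] at this
    rcases h5 with rfl | h5
    · rcases h6 with rfl | h6
      · omega
      · exact h9 _ h6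
    · exact h9 _ h5
  · intro h7
    obtain ⟨i, hi⟩ := Finset.nonempty_iff_ne_empty.2 h7
    rw [mem_shorts] at hi
    have hib := hi.bounds
    rcases h5 with rfl | h5
    · rcases h6 with rfl | h6
      · exact absurd hi (h4 i hib.1 (by omega))
      · have := h6.bounds
        omega
    · have := h5.bounds
      omega

theorem sum_mul_B {n : ℕ} (hn : 1 ≤ n) (g : ℕ → ℕ) :
    ∑ p ∈ Icc 1 (2*n-2), g p * B n p
      = ∑ f ∈ diagramsWithShort n ∅, if shorts n f = ∅ then 0 else
          ∑ β ∈ bubbles n f, g (β.2 - β.1 + 1) := by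
  classical
  have hB : ∀ p, B n p
      = ∑ f ∈ diagramsWithShort n ∅, ∑ β ∈ bubbles n f, if β.2 - β.1 + 1 = p then 1 else 0 := by
    intro p
    rw [B, card_filter, sum_product, diagramsWithShort, sum_filter]
    refine Finset.sum_congr rfl fun f _ => ?_
    by_cases hf : IsLCD n f
    · rw [if_pos (by simpa using hf), bubbles, sum_filter]
      refine Finset.sum_congr rfl fun β _ => ?_
      by_cases hβ : IsBubble n f β.1 β.2 <;> simp [hf, hβ]
    · simp [hf]
  simp_rw [hB, mul_sum]
  rw [Finset.sum_comm]
  refine Finset.sum_congr rfl fun f _ => ?_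
  rw [Finset.sum_comm]
  have h1 : ∀ β ∈ bubbles n f,
      ∑ p ∈ Icc 1 (2*n-2), g p * (if β.2 - β.1 + 1 = p then 1 else 0)
        = if shorts n f = ∅ then 0 else g (β.2 - β.1 + 1) := by
    intro β hβ
    have := (mem_bubbles.1 hβ).size_le_iff hn
    simp only [mul_ite, mul_one, mul_zero, Finset.sum_ite_eq, mem_Icc, this]
    simp
  rw [Finset.sum_congr rfl h1]
  split_ifs <;> simp

theorem sum_card_shorts {n : ℕ} (hn : 1 ≤ n) :
    ∑ f ∈ diagramsWithShort n ∅, (#(shorts n f) : ℝ) = #(diagramsWithShort n ∅) := by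
  have h1 : ∀ f : Fin (2*n) → Fin (2*n), (#(shorts n f) : ℝ)
      = ∑ i ∈ Icc 1 (2*n-1), if {i} ⊆ shorts n f then (1 : ℝ) else 0 := by
    intro f
    rw [← Finset.sum_filter, sum_const, nsmul_eq_mul, mul_one]
    congr 2
    ext i
    simp only [mem_filter, singleton_subset_iff, iff_and_self]
    exact fun h => shorts_subset h
  rw [Finset.sum_congr rfl fun f _ => h1 f, Finset.sum_comm]
  have h2 : ∀ i ∈ Icc 1 (2*n-1),
      (∑ f ∈ diagramsWithShort n ∅, if {i} ⊆ shorts n f then (1 : ℝ) else 0)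
        = #(diagramsWithShort n ∅) / ((2 * n - 1 : ℕ) : ℝ) := by
    intro i hi
    rw [← Finset.sum_filter, sum_const, nsmul_eq_mul, mul_one, ← diagramsWithShort_eq_filter,
      card_diagramsWithShort_eq_div {i} (by simpa using hi) (by simp)]
    simp
  have h3 : ((2 * n - 1 : ℕ) : ℝ) ≠ 0 := by
    have : 2 * n - 1 ≠ 0 := by omega
    exact_mod_cast this
  rw [Finset.sum_congr rfl h2, sum_const, nsmul_eq_mul, Nat.card_Icc, Nat.add_sub_cancel]
  field_simp

theorem sum_emptyGaps {n : ℕ} (hn : 2 ≤ n) :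
    ∑ f ∈ diagramsWithShort n ∅, (emptyGaps n f : ℝ)
      = #(diagramsWithShort n ∅) * (3 / ((2 * n - 1 : ℕ) : ℝ)) := by
  have h1 : ∀ S : Finset ℕ,
      (∑ f ∈ diagramsWithShort n ∅, if S ⊆ shorts n f then (1 : ℝ) else 0)
        = #(diagramsWithShort n S) := by
    intro S
    rw [← Finset.sum_filter, sum_const, nsmul_eq_mul, mul_one, ← diagramsWithShort_eq_filter]
  have h2 : ∀ i ∈ Icc 1 (2*n-1), (#(diagramsWithShort n {i}) : ℝ)
      = #(diagramsWithShort n ∅) / ((2 * n - 1 : ℕ) : ℝ) := by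
    intro i hi
    rw [card_diagramsWithShort_eq_div {i} (by simpa using hi) (by simp)]
    simp
  have h3 : ∀ i ∈ Icc 1 (2*n-3), (#(diagramsWithShort n {i, i + 2}) : ℝ)
      = #(diagramsWithShort n ∅) / (((2 * n - 1 : ℕ) : ℝ) * ((2 * n - 3 : ℕ) : ℝ)) := by
    intro i hi
    rw [mem_Icc] at hi
    rw [card_diagramsWithShort_eq_div {i, i + 2}, card_pair (by omega), prod_range_succ,
      prod_range_one]
    · push_cast
      rw [show 2 * n - 1 - 2 * 0 = 2 * n - 1 by omega,
        show 2 * n - 1 - 2 * 1 = 2 * n - 3 by omega]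
    · simp only [insert_subset_iff, singleton_subset_iff, mem_Icc]
      omega
    · simp only [mem_insert, mem_singleton, forall_eq_or_imp, forall_eq]
      omega
  have h4 : ((2 * n - 1 : ℕ) : ℝ) ≠ 0 := by
    have : 2 * n - 1 ≠ 0 := by omega
    exact_mod_cast this
  have h5 : ((2 * n - 3 : ℕ) : ℝ) ≠ 0 := by
    have : 2 * n - 3 ≠ 0 := by omega
    exact_mod_cast this
  simp only [emptyGaps, card_filter, Nat.cast_add, Nat.cast_sum, Nat.cast_ite, Nat.cast_one,
    Nat.cast_zero, sum_add_distrib]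
  rw [Finset.sum_comm]
  simp only [h1]
  rw [Finset.sum_congr rfl h3, h2 1 (by rw [mem_Icc]; omega), h2 (2*n-1) (by rw [mem_Icc]; omega),
    sum_const, nsmul_eq_mul, Nat.card_Icc, Nat.add_sub_cancel]
  field_simp
  ring

/-- The probability that a uniformly random linear chord diagram has no short chord. -/
noncomputable def noShortProb (n : ℕ) : ℝ := ∑' j, (-1 : ℝ) ^ j * shortFactorialMoment n j

theorem sum_shorts_ne_empty {n : ℕ} (hn : 1 ≤ n) :
    (∑ f ∈ diagramsWithShort n ∅, if shorts n f = ∅ then (0 : ℝ) else 1)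
      = #(diagramsWithShort n ∅) * (1 - noShortProb n) := by
  have h := card_filter_shorts_eq_empty hn
  rw [← noShortProb, Finset.card_filter] at h
  push_cast at h
  rw [mul_sub, ← h, mul_one, ← nsmul_one, ← sum_const, ← sum_sub_distrib]
  refine Finset.sum_congr rfl fun f _ => ?_
  split_ifs <;> simp

theorem sum_size_mul_B_bounds {n : ℕ} (hn : 1 ≤ n) :
    (#(diagramsWithShort n ∅) : ℝ) * (2 * n * (1 - noShortProb n) - 2)
        ≤ (∑ p ∈ Icc 1 (2*n-2), p * B n p : ℕ) ∧
      ((∑ p ∈ Icc 1 (2*n-2), p * B n p : ℕ) : ℝ)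
        ≤ #(diagramsWithShort n ∅) * (2 * n * (1 - noShortProb n)) := by
  rw [sum_mul_B hn (fun p => p), mul_sub, mul_left_comm, ← sum_shorts_ne_empty hn, mul_comm _ 2,
    ← sum_card_shorts hn, mul_sum, mul_sum, ← sum_sub_distrib]
  push_cast
  constructor <;> refine Finset.sum_le_sum fun f hf => ?_
  · split_ifs with h
    · simp [h]
    · have := le_sum_size_bubbles (mem_diagramsWithShort.1 hf).1
      have h2 : (2 * n : ℝ) ≤ ∑ β ∈ bubbles n f, (((β.2 - β.1 : ℕ) : ℝ) + 1)
          + 2 * #(shorts n f) := by exact_mod_cast this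
      linarith
  · split_ifs with h
    · simp
    · have := sum_size_bubbles_le (mem_diagramsWithShort.1 hf).1
      rw [mul_one]
      exact_mod_cast this

theorem sum_B_bounds {n : ℕ} (hn : 2 ≤ n) :
    (#(diagramsWithShort n ∅) : ℝ) * (2 - noShortProb n - 3 / ((2 * n - 1 : ℕ) : ℝ))
        ≤ (∑ p ∈ Icc 1 (2*n-2), B n p : ℕ) ∧
      ((∑ p ∈ Icc 1 (2*n-2), B n p : ℕ) : ℝ)
        ≤ #(diagramsWithShort n ∅) * (2 - noShortProb n) := by
  have h1 := sum_mul_B (by omega : 1 ≤ n) (fun _ => 1)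
  simp only [one_mul, sum_const, smul_eq_mul, mul_one] at h1
  have h2 : (#(diagramsWithShort n ∅) : ℝ) * (2 - noShortProb n)
      = ∑ f ∈ diagramsWithShort n ∅,
        ((#(shorts n f) : ℝ) + if shorts n f = ∅ then (0 : ℝ) else 1) := by
    rw [sum_add_distrib, sum_card_shorts (by omega), sum_shorts_ne_empty (by omega)]
    ring
  rw [mul_sub, h2, h1, ← sum_emptyGaps hn, ← sum_sub_distrib]
  push_cast
  constructor <;> refine Finset.sum_le_sum fun f hf => ?_
  · split_ifs with h
    · simp [h]
    · have := card_shorts_le (by omega) (mem_diagramsWithShort.1 hf).1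
      have h3 : (#(shorts n f) : ℝ) + 1 ≤ #(bubbles n f) + emptyGaps n f := by exact_mod_cast this
      linarith
  · split_ifs with h
    · simp [h]
    · exact_mod_cast card_bubbles_le (mem_diagramsWithShort.1 hf).1

/-- The mean size of bubbles of size at most `2n-2` is asymptotically
`(2 - 2e⁻¹)/(2 - e⁻¹) · n`. -/
theorem truncated_mean_bubble_size_asymptotic :
    Filter.Tendsto (fun n : ℕ =>
      ((∑ p ∈ Finset.Icc 1 (2*n-2), p * B n p : ℕ) : ℝ) /
        ((n : ℝ) * ((∑ p ∈ Finset.Icc 1 (2*n-2), B n p : ℕ) : ℝ)))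
      Filter.atTop
      (nhds ((2 - 2 * (Real.exp 1)⁻¹) / (2 - (Real.exp 1)⁻¹))) := by
  have hr : Filter.Tendsto noShortProb Filter.atTop (nhds (Real.exp 1)⁻¹) :=
    tendsto_tsum_shortFactorialMoment
  have hD : ∀ n, 0 < (#(diagramsWithShort n ∅) : ℝ) := fun n => by
    exact_mod_cast card_diagramsWithShort_empty_pos n
  have hnum : Filter.Tendsto (fun n : ℕ => ((∑ p ∈ Finset.Icc 1 (2*n-2), p * B n p : ℕ) : ℝ) /
      (n * #(diagramsWithShort n ∅))) Filter.atTop (nhds (2 - 2 * (Real.exp 1)⁻¹)) := by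
    have hupper := (hr.const_mul 2).const_sub 2
    have hlower := hupper.sub (tendsto_const_div_atTop_nhds_zero_nat (2 : ℝ))
    rw [sub_zero] at hlower
    refine tendsto_of_tendsto_of_tendsto_of_le_of_le' hlower hupper ?_ ?_ <;>
      filter_upwards [Filter.eventually_ge_atTop 1] with n hn
    · have hn' : (0 : ℝ) < n := by exact_mod_cast hn
      rw [le_div_iff₀ (mul_pos hn' (hD n))]
      refine le_of_eq_of_le ?_ (sum_size_mul_B_bounds hn).1
      field_simp
    · have hn' : (0 : ℝ) < n := by exact_mod_cast hn
      rw [div_le_iff₀ (mul_pos hn' (hD n))]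
      refine (sum_size_mul_B_bounds hn).2.trans_eq ?_
      ring
  have hden : Filter.Tendsto (fun n : ℕ => ((∑ p ∈ Finset.Icc 1 (2*n-2), B n p : ℕ) : ℝ) /
      #(diagramsWithShort n ∅)) Filter.atTop (nhds (2 - (Real.exp 1)⁻¹)) := by
    have hupper := hr.const_sub 2
    have hzero : Filter.Tendsto (fun n : ℕ => 3 / ((2 * n - 1 : ℕ) : ℝ)) Filter.atTop
        (nhds 0) := by
      refine (tendsto_const_div_atTop_nhds_zero_nat (3 : ℝ)).comp
        (Filter.tendsto_atTop_mono (fun n => ?_) Filter.tendsto_id)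
      simp only [id]
      omega
    have hlower := hupper.sub hzero
    rw [sub_zero] at hlower
    refine tendsto_of_tendsto_of_tendsto_of_le_of_le' hlower hupper ?_ ?_ <;>
      filter_upwards [Filter.eventually_ge_atTop 2] with n hn
    · rw [le_div_iff₀' (hD n)]
      exact (sum_B_bounds hn).1
    · rw [div_le_iff₀' (hD n)]
      exact (sum_B_bounds hn).2
  have hne : 2 - (Real.exp 1)⁻¹ ≠ 0 := by
    have : (Real.exp 1)⁻¹ < 1 := inv_lt_one_of_one_lt₀ (Real.one_lt_exp_iff.2 one_pos)
    linarith
  refine (hnum.div hden hne).congr fun n => ?_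
  have := (hD n).ne'
  simp only [Pi.div_apply]
  rw [div_div_eq_mul_div, div_mul_eq_mul_div, mul_div_mul_right _ _ this, div_div]
end

section
/- The total number of bubbles across all linear chord diagrams on 2n vertices is asymptotic to 2·(2n-1)!!: the sequence n ↦ (∑_{p=1}^{2n} B_{n,p}) / (2n-1)!! tends to 2 as n → ∞, where (2n-1)!! = (2n)!/(2^n·n!). -/
open Finset

open scoped Classical in
/-- The linear chord diagrams on `2n` vertices. -/
noncomputable def lcd (n : ℕ) : Finset (Fin (2*n) → Fin (2*n)) :=
  univ.filter (IsLCD n)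

lemma mem_lcd {n : ℕ} {f : Fin (2*n) → Fin (2*n)} : f ∈ lcd n ↔ IsLCD n f := by
  simp [lcd]

lemma IsLCD.injective {n : ℕ} {f : Fin (2*n) → Fin (2*n)} (hf : IsLCD n f) :
    Function.Injective f :=
  Function.LeftInverse.injective (g := f) fun i => (hf i).1

lemma isLCD_arrowCongr {n : ℕ} (e : Equiv.Perm (Fin (2*n))) (f : Fin (2*n) → Fin (2*n)) :
    IsLCD n (e.arrowCongr e f) ↔ IsLCD n f := by
  constructor
  · intro h i
    have := h (e i)
    simpa [Equiv.arrowCongr_apply] using this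
  · intro h i
    have := h (e.symm i)
    simp only [Equiv.arrowCongr_apply, Function.comp_apply, Equiv.symm_apply_apply, this.1,
      Equiv.apply_symm_apply, true_and]
    intro hfix
    exact this.2 (e.injective (by simpa using hfix))

/-- Relabelling the vertices by `e` preserves the number of diagrams. -/
lemma card_filter_lcd_congr {n : ℕ} (e : Equiv.Perm (Fin (2*n)))
    {P Q : (Fin (2*n) → Fin (2*n)) → Prop} [DecidablePred P] [DecidablePred Q]
    (h : ∀ f, P f ↔ Q (e.arrowCongr e f)) :
    ((lcd n).filter P).card = ((lcd n).filter Q).card :=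
  Finset.card_equiv (e.arrowCongr e) fun f => by
    simp only [mem_filter, mem_lcd, isLCD_arrowCongr, h]

open scoped Classical in
/-- A chord with endpoint `i` has any of the other `2n - 1` vertices as its second endpoint
equally often. -/
lemma card_lcd_apply_eq {n : ℕ} {i j : Fin (2*n)} (hij : j ≠ i) :
    (2*n - 1) * ((lcd n).filter (fun f => f i = j)).card = (lcd n).card := by
  rw [Finset.card_eq_sum_card_fiberwise (s := lcd n) (f := fun f => f i) (t := univ.erase i)]
  · rw [Finset.sum_congr rfl (g := fun _ => ((lcd n).filter (fun f => f i = j)).card)]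
    · simp
    · intro k hk
      have hk : k ≠ i := by simpa using hk
      refine (card_filter_lcd_congr (Equiv.swap j k) fun f => ?_).symm
      simp [Equiv.arrowCongr_apply, Equiv.swap_apply_of_ne_of_ne hij.symm hk.symm,
        Equiv.swap_apply_eq_iff]
  · intro f hf
    simpa using (mem_lcd.1 hf i).2

open scoped Classical in
lemma card_lcd_apply_eq_and {n : ℕ} {i j k l : Fin (2*n)} (hij : j ≠ i) (hik : k ≠ i)
    (hjk : k ≠ j) (hli : l ≠ i) (hlj : l ≠ j) (hlk : l ≠ k) :
    (2*n - 3) * ((lcd n).filter (fun f => f i = j ∧ f k = l)).card =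
      ((lcd n).filter (fun f => f i = j)).card := by
  rw [Finset.card_eq_sum_card_fiberwise
    (s := (lcd n).filter (fun f => f i = j)) (f := fun f => f k) (t := univ \ {i, j, k})]
  · rw [Finset.sum_congr rfl (g := fun _ => ((lcd n).filter (fun f => f i = j ∧ f k = l)).card)]
    · have h3 : ({i, j, k} : Finset (Fin (2*n))).card = 3 :=
        Finset.card_eq_three.2 ⟨i, j, k, hij.symm, hik.symm, hjk.symm, rfl⟩
      rw [Finset.sum_const, Finset.card_sdiff_of_subset (Finset.subset_univ _), h3]
      simp
    · intro m hm
      simp only [mem_sdiff, mem_univ, mem_insert, mem_singleton, not_or, true_and] at hm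
      rw [Finset.filter_filter]
      refine (card_filter_lcd_congr (Equiv.swap l m) fun f => ?_).symm
      simp [Equiv.arrowCongr_apply, Equiv.swap_apply_of_ne_of_ne hli.symm (Ne.symm hm.1),
        Equiv.swap_apply_of_ne_of_ne hlk.symm (Ne.symm hm.2.2),
        Equiv.swap_apply_eq_iff, Equiv.swap_apply_of_ne_of_ne hlj.symm (Ne.symm hm.2.1)]
  · intro f hf
    simp only [coe_filter, Set.mem_ofPred_eq, mem_lcd] at hf
    obtain ⟨hf, hfi⟩ := hf
    have hfj : f j = i := by rw [← hfi, (hf i).1]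
    simp only [coe_sdiff, coe_univ, Set.mem_sdiff, Set.mem_univ, true_and, coe_insert,
      coe_singleton, Set.mem_insert_iff, Set.mem_singleton_iff, not_or]
    refine ⟨fun h => hjk (hf.injective (h.trans hfj.symm)),
      fun h => hik (hf.injective (h.trans hfi.symm)), (hf k).2⟩

lemma isShort_iff_s14 {n i : ℕ} (h1 : 1 ≤ i) (h2 : i < 2*n) (f : Fin (2*n) → Fin (2*n)) :
    IsShort n f i ↔ f ⟨i-1, by omega⟩ = ⟨i, h2⟩ :=
  ⟨fun ⟨_, _, h⟩ => h, fun h => ⟨h1, h2, h⟩⟩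

lemma IsLCD.not_isShort_succ {n : ℕ} {f : Fin (2*n) → Fin (2*n)} (hf : IsLCD n f) {i : ℕ}
    (h : IsShort n f i) : ¬ IsShort n f (i+1) := by
  rintro ⟨_, h2, h'⟩
  obtain ⟨h3, h4, h⟩ := h
  have : f ⟨i, h4⟩ = ⟨i-1, by omega⟩ := by rw [← h, (hf _).1]
  simp only [Nat.add_sub_cancel] at h'
  rw [this, Fin.mk.injEq] at h'
  omega

open scoped Classical in
lemma card_lcd_isShort {n i : ℕ} (h1 : 1 ≤ i) (h2 : i < 2*n) :
    (2*n - 1) * ((lcd n).filter (fun f => IsShort n f i)).card = (lcd n).card := by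
  simp only [isShort_iff_s14 h1 h2]
  exact card_lcd_apply_eq (by simp only [ne_eq, Fin.mk.injEq]; omega)

open scoped Classical in
lemma card_lcd_isShort_and {n i : ℕ} (h1 : 1 ≤ i) (h2 : i + 2 < 2*n) :
    (2*n - 3) * ((lcd n).filter (fun f => IsShort n f i ∧ IsShort n f (i+2))).card =
      ((lcd n).filter (fun f => IsShort n f i)).card := by
  simp only [isShort_iff_s14 h1 (show i < 2*n by omega),
    isShort_iff_s14 (show 1 ≤ i + 2 by omega) h2]
  apply card_lcd_apply_eq_and <;> simp only [ne_eq, Fin.mk.injEq] <;> omega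

lemma cycleType_eq_replicate_two_iff {n : ℕ} (g : Equiv.Perm (Fin (2*n))) :
    g.cycleType = Multiset.replicate n 2 ↔ IsLCD n g := by
  constructor
  · intro h i
    have hsq : g ^ 2 = 1 := by
      rw [← orderOf_dvd_iff_pow_eq_one, ← Equiv.Perm.lcm_cycleType, h, Multiset.lcm_dvd]
      intro b hb
      rw [Multiset.eq_of_mem_replicate hb]
    have hsupp : g.support = univ := by
      rw [← Finset.card_eq_iff_eq_univ, ← Equiv.Perm.sum_cycleType, h]
      simp [mul_comm]
    refine ⟨?_, ?_⟩
    · have := congrArg (fun σ : Equiv.Perm (Fin (2*n)) => σ i) hsq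
      simpa [pow_two] using this
    · rw [← Equiv.Perm.mem_support, hsupp]
      exact mem_univ i
  · intro h
    have hsq : g ^ 2 = 1 := by
      ext i
      simp [pow_two, (h i).1]
    have hsupp : g.support = univ := by
      ext i
      simpa using (h i).2
    have hr := Equiv.Perm.cycleType_of_pow_prime_eq_one hsq
    have hs := g.sum_cycleType
    rw [hr, hsupp] at hs
    simp only [Multiset.sum_replicate, smul_eq_mul, card_univ, Fintype.card_fin] at hs
    rw [hr]
    congr 1
    omega

lemma card_lcd (n : ℕ) : (lcd n).card = doubleFact n := by
  have h := Equiv.Perm.card_of_cycleType (Fin (2*n)) (Multiset.replicate n 2)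
  rw [if_pos (by
    refine ⟨by simp [mul_comm], fun a ha => (Multiset.eq_of_mem_replicate ha).ge⟩)] at h
  have hr : (lcd n).card =
      (univ.filter (fun g : Equiv.Perm (Fin (2*n)) =>
        g.cycleType = Multiset.replicate n 2)).card := by
    symm
    refine Finset.card_bij (fun g _ => ⇑g) ?_ ?_ ?_
    · intro g hg
      exact mem_lcd.2 ((cycleType_eq_replicate_two_iff g).1 (by simpa using hg))
    · intro g _ g' _ h
      exact DFunLike.coe_injective h
    · intro f hf
      have hf := mem_lcd.1 hf
      refine ⟨⟨f, f, fun i => (hf i).1, fun i => (hf i).1⟩, ?_, rfl⟩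
      simpa using (cycleType_eq_replicate_two_iff _).2 hf
  rw [hr, h, doubleFact]
  rcases Nat.eq_zero_or_pos n with rfl | hn
  · simp
  · simp [Multiset.toFinset_replicate, hn.ne', mul_comm n 2]

/-- A bubble is determined by its left end, which is the start of the diagram or follows
a short chord, and is not itself the start of a short chord. -/
lemma exists_isBubble_iff {n : ℕ} {f : Fin (2*n) → Fin (2*n)} (hf : IsLCD n f) {a : ℕ}
    (h1 : 1 ≤ a) (h2 : a ≤ 2*n) :
    (∃ b, IsBubble n f a b) ↔ (a = 1 ∨ IsShort n f (a-2)) ∧ ¬ IsShort n f a := by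
  classical
  constructor
  · rintro ⟨b, _, hab, hb, hno, ha, hb'⟩
    refine ⟨ha, fun hs => ?_⟩
    rcases hab.lt_or_eq with hlt | rfl
    · exact hno a le_rfl hlt hs
    · rcases hb' with rfl | hb'
      · obtain ⟨_, h, _⟩ := hs
        omega
      · exact hf.not_isShort_succ hs hb'
  · rintro ⟨ha, hs⟩
    have hex : ∃ b, a ≤ b ∧ (b = 2*n ∨ IsShort n f (b+1)) := ⟨2*n, h2, Or.inl rfl⟩
    obtain ⟨hab, hb⟩ := Nat.find_spec hex
    refine ⟨Nat.find hex, h1, hab, Nat.find_min' hex ⟨h2, Or.inl rfl⟩, ?_, ha, hb⟩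
    intro i hi hib his
    rcases hi.lt_or_eq with hlt | rfl
    · refine Nat.find_min hex (m := i - 1) (by omega) ⟨by omega, Or.inr ?_⟩
      rwa [Nat.sub_add_cancel (by omega)]
    · exact hs his

lemma IsBubble.right_le {n : ℕ} {f : Fin (2*n) → Fin (2*n)} (hf : IsLCD n f) {a b b' : ℕ}
    (h : IsBubble n f a b) (h' : IsBubble n f a b') : b' ≤ b := by
  obtain ⟨_, hab, hb, -, -, hr⟩ := h
  obtain ⟨_, hab', hb', hno, -, hr'⟩ := h'
  by_contra! hlt
  have hs : IsShort n f (b+1) := hr.resolve_left (by omega)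
  rcases (show b + 1 ≤ b' from hlt).lt_or_eq with hlt' | rfl
  · exact hno (b+1) (by omega) (by omega) hs
  · rcases hr' with hr' | hr'
    · obtain ⟨_, h, _⟩ := hs
      omega
    · exact hf.not_isShort_succ hs hr'

open scoped Classical in
lemma sum_B_eq_s14 (n : ℕ) :
    ∑ p ∈ Finset.Icc 1 (2*n), B n p =
      ∑ a ∈ Finset.Icc 1 (2*n), ((lcd n).filter
        (fun f => (a = 1 ∨ IsShort n f (a-2)) ∧ ¬ IsShort n f a)).card := by
  have hL : ∑ p ∈ Finset.Icc 1 (2*n), B n p =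
      ((univ ×ˢ (Finset.Icc 1 (2*n) ×ˢ Finset.Icc 1 (2*n))).filter
        (fun x : (Fin (2*n) → Fin (2*n)) × ℕ × ℕ =>
          IsLCD n x.1 ∧ IsBubble n x.1 x.2.1 x.2.2)).card := by
    rw [Finset.card_eq_sum_card_fiberwise (f := fun x => x.2.2 - x.2.1 + 1)
      (t := Finset.Icc 1 (2*n))]
    · simp only [B, Finset.filter_filter, and_assoc]
    · rintro ⟨f, a, b⟩ hx
      simp only [coe_filter, Set.mem_ofPred_eq, mem_product, mem_Icc] at hx
      simp only [coe_Icc, Set.mem_Icc]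
      omega
  rw [hL, ← Finset.card_sigma]
  refine Finset.card_bij (fun x _ => ⟨x.2.1, x.1⟩) ?_ ?_ ?_
  · rintro ⟨f, a, b⟩ hx
    simp only [mem_filter, mem_product, mem_Icc, mem_univ, true_and] at hx
    obtain ⟨⟨⟨h1, h2⟩, -⟩, hf, hb⟩ := hx
    simp only [mem_sigma, mem_Icc, mem_filter, mem_lcd]
    exact ⟨⟨h1, h2⟩, hf, (exists_isBubble_iff hf h1 h2).1 ⟨b, hb⟩⟩
  · rintro ⟨f, a, b⟩ hx ⟨f', a', b'⟩ hx' h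
    simp only [mem_filter] at hx hx'
    simp only [Sigma.mk.injEq, heq_eq_eq] at h
    obtain ⟨rfl, rfl⟩ := h
    rw [(hx'.2.2.right_le hx.2.1 hx.2.2).antisymm (hx.2.2.right_le hx.2.1 hx'.2.2)]
  · rintro ⟨a, f⟩ hx
    simp only [mem_sigma, mem_Icc, mem_filter, mem_lcd] at hx
    obtain ⟨⟨h1, h2⟩, hf, hs⟩ := hx
    obtain ⟨b, hb⟩ := (exists_isBubble_iff hf h1 h2).2 hs
    refine ⟨⟨f, a, b⟩, ?_, rfl⟩
    simp only [mem_filter, mem_product, mem_Icc, mem_univ, true_and]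
    exact ⟨⟨⟨h1, h2⟩, h1.trans hb.2.1, hb.2.2.1⟩, hf, hb⟩

lemma not_isShort_zero {n : ℕ} (f : Fin (2*n) → Fin (2*n)) : ¬ IsShort n f 0 :=
  fun ⟨h, _⟩ => absurd h (by omega)

lemma not_isShort_two_mul {n : ℕ} (f : Fin (2*n) → Fin (2*n)) : ¬ IsShort n f (2*n) :=
  fun ⟨_, h, _⟩ => absurd h (by omega)

lemma sum_B_eq_mul {n : ℕ} (hn : 2 ≤ n) :
    ((∑ p ∈ Finset.Icc 1 (2*n), B n p : ℕ) : ℝ) =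
      (2 - 3 / (2*n - 1)) * (doubleFact n : ℝ) := by
  classical
  have hn' : (2:ℝ) ≤ n := by exact_mod_cast hn
  have hd1 : (2*n - 1 : ℝ) ≠ 0 := by linarith
  have hd3 : (2*n - 3 : ℝ) ≠ 0 := by linarith
  set N : ℝ := (doubleFact n : ℝ)
  have hc : ∀ i, 1 ≤ i → i < 2*n →
      (((lcd n).filter (fun f => IsShort n f i)).card : ℝ) = N / (2*n - 1) := by
    intro i h1 h2
    have h := card_lcd_isShort h1 h2
    rw [card_lcd] at h
    have h := congrArg (Nat.cast : ℕ → ℝ) h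
    push_cast [Nat.cast_sub (show 1 ≤ 2*n by omega)] at h
    rw [eq_div_iff hd1, mul_comm, h]
  have he : ∀ i, 1 ≤ i → i + 2 < 2*n →
      (((lcd n).filter (fun f => IsShort n f i ∧ IsShort n f (i+2))).card : ℝ) =
        N / (2*n - 1) / (2*n - 3) := by
    intro i h1 h2
    have h := congrArg (Nat.cast : ℕ → ℝ) (card_lcd_isShort_and h1 h2)
    push_cast [Nat.cast_sub (show 3 ≤ 2*n by omega)] at h
    rw [hc i h1 (by omega)] at h
    rw [eq_div_iff hd3, mul_comm, h]
  rw [sum_B_eq_s14]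
  push_cast
  have hsplit : Finset.Icc 1 (2*n) = insert 1 (insert 2 (insert (2*n) (Finset.Ico 3 (2*n)))) := by
    ext a
    simp only [mem_Icc, mem_insert, mem_Ico]
    omega
  rw [hsplit, Finset.sum_insert (by simp; omega), Finset.sum_insert (by simp; omega),
    Finset.sum_insert (by simp)]
  have t1 : (((lcd n).filter (fun f => ((1:ℕ) = 1 ∨ IsShort n f (1-2)) ∧
      ¬ IsShort n f 1)).card : ℝ) = N - N / (2*n - 1) := by
    have h := Finset.card_filter_add_card_filter_not (s := lcd n) (fun f => IsShort n f 1)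
    rw [card_lcd] at h
    have h := congrArg (Nat.cast : ℕ → ℝ) h
    push_cast at h
    rw [hc 1 le_rfl (by omega)] at h
    simp only [true_or, true_and]
    linarith
  have t2 : (((lcd n).filter (fun f => ((2:ℕ) = 1 ∨ IsShort n f (2-2)) ∧
      ¬ IsShort n f 2)).card : ℝ) = 0 := by
    simp [not_isShort_zero]
  have t3 : (((lcd n).filter (fun f => (2*n = 1 ∨ IsShort n f (2*n-2)) ∧
      ¬ IsShort n f (2*n))).card : ℝ) = N / (2*n - 1) := by
    simp only [not_isShort_two_mul, not_false_eq_true, and_true, show ¬ (2*n = 1) by omega,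
      false_or]
    exact hc _ (by omega) (by omega)
  have t4 : ∀ a ∈ Finset.Ico 3 (2*n), (((lcd n).filter (fun f =>
      (a = 1 ∨ IsShort n f (a-2)) ∧ ¬ IsShort n f a)).card : ℝ) =
        N / (2*n - 1) - N / (2*n - 1) / (2*n - 3) := by
    intro a ha
    obtain ⟨h1, h2⟩ := Finset.mem_Ico.1 ha
    have h := Finset.card_filter_add_card_filter_not
      (s := (lcd n).filter (fun f => IsShort n f (a-2))) (fun f => IsShort n f a)
    simp only [Finset.filter_filter] at h
    have h := congrArg (Nat.cast : ℕ → ℝ) h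
    have he' := he (a-2) (by omega) (by omega)
    rw [Nat.sub_add_cancel (by omega)] at he'
    push_cast at h
    rw [hc _ (by omega) (by omega), he'] at h
    simp only [show ¬ (a = 1) by omega, false_or]
    linarith
  rw [t1, t2, t3, Finset.sum_congr rfl t4, Finset.sum_const, Nat.card_Ico, nsmul_eq_mul]
  push_cast [Nat.cast_sub (show 3 ≤ 2*n by omega)]
  field_simp
  ring

/-- The total number of bubbles across all linear chord diagrams on `2n` vertices is
asymptotic to `2·(2n-1)!!`, where `(2n-1)!! = (2n)!/(2^n·n!)`. -/
theorem total_bubble_count_asymptotic :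
    Filter.Tendsto (fun n : ℕ =>
      ((∑ p ∈ Finset.Icc 1 (2*n), B n p : ℕ) : ℝ) / ((doubleFact n : ℕ) : ℝ))
      Filter.atTop (nhds 2) := by
  have hlim : Filter.Tendsto (fun n : ℕ => (2 : ℝ) - 3 / (2*n - 1)) Filter.atTop (nhds (2 - 0)) := by
    refine tendsto_const_nhds.sub (Filter.Tendsto.const_div_atTop ?_ 3)
    refine Filter.tendsto_atTop_add_const_right _ (-1 : ℝ) ?_
    exact tendsto_natCast_atTop_atTop.const_mul_atTop two_pos
  rw [sub_zero] at hlim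
  refine hlim.congr' ?_
  filter_upwards [Filter.eventually_ge_atTop 2] with n hn
  rw [sum_B_eq_mul hn, mul_div_cancel_right₀]
  have hpos : 0 < doubleFact n :=
    Nat.div_pos (Nat.two_pow_mul_factorial_le_factorial_two_mul n) (by positivity)
  exact_mod_cast hpos.ne'
end
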